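/- arXiv:2205.15054 — 2 statements merged into one kernel-verified Lean document; each statement's English description precedes it below -/
import Mathlib

section
/- There exists a universal constant C > 0 such that for every n ≥ 1, every 0 < ε ≤ 1 and every β ≥ 1, one has P_n^β({(x_1,…,x_n) : max_{1≤j≤n} |x_j| > 2 + ε}) ≤ C·exp(−n β ε^{3/2}/C). -/
open MeasureTheory Filter Topology
open scoped ENNReal

/-- The (unnormalized) density of the Gaussian beta-ensemble with potential `x^2/2`. -/
noncomputable def gaussianDensity (n : ℕ) (β : ℝ) (x : Fin n → ℝ) : ℝ :=
  (∏ p ∈ Finset.univ.filter (fun p : Fin n × Fin n => p.1 < p.2), |x p.1 - x p.2| ^ β) *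
    Real.exp (-((n : ℝ) * β / 2) * ∑ j, (x j) ^ 2 / 2)

theorem ENNReal.add_le_add_of_mul_le_mul {a b c d : ℝ≥0∞} (ha : a ≤ c) (hb : b ≤ c)
    (hab : a * b ≤ c * d) : a + b ≤ c + d := by
  rcases eq_or_ne c ⊤ with rfl | hc
  · simp
  rcases eq_or_ne d ⊤ with rfl | hd
  · simp
  have ha' : a ≠ ⊤ := ne_top_of_le_ne_top hc ha
  have hb' : b ≠ ⊤ := ne_top_of_le_ne_top hc hb
  lift a to NNReal using ha'
  lift b to NNReal using hb'
  lift c to NNReal using hc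
  lift d to NNReal using hd
  norm_cast at *
  rcases eq_or_ne c 0 with rfl | h0
  · have : a = 0 := by simpa using ha
    have : b = 0 := by simpa using hb
    simp_all
  have hpos : (0 : ℝ) < c := by positivity
  rw [← NNReal.coe_le_coe] at *
  push_cast at *
  have : ((a : ℝ) + b) * c ≤ (c + d) * c := by nlinarith
  exact le_of_mul_le_mul_right this hpos

/-- The one-dimensional continuous four functions theorem. -/
theorem four_functions_lintegral_real {f₁ f₂ f₃ f₄ : ℝ → ℝ≥0∞}
    (h₁ : Measurable f₁) (h₂ : Measurable f₂) (h₃ : Measurable f₃) (h₄ : Measurable f₄)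
    (h : ∀ x y, f₁ x * f₂ y ≤ f₃ (x ⊔ y) * f₄ (x ⊓ y)) :
    (∫⁻ x, f₁ x) * ∫⁻ x, f₂ x ≤ (∫⁻ x, f₃ x) * ∫⁻ x, f₄ x := by
  have key : ∀ x y, x ≤ y → f₁ x * f₂ y + f₁ y * f₂ x ≤ f₃ x * f₄ y + f₃ y * f₄ x := by
    intro x y hxy
    rw [add_comm (f₃ x * f₄ y)]
    have e1 := h x y
    have e2 := h y x
    have e3 := h x x
    have e4 := h y y
    simp only [sup_of_le_right hxy, sup_of_le_left hxy, inf_of_le_left hxy, inf_of_le_right hxy,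
      sup_idem, inf_idem] at e1 e2 e3 e4
    refine ENNReal.add_le_add_of_mul_le_mul e1 e2 ?_
    calc f₁ x * f₂ y * (f₁ y * f₂ x) = (f₁ x * f₂ x) * (f₁ y * f₂ y) := by ring
      _ ≤ (f₃ x * f₄ x) * (f₃ y * f₄ y) := by gcongr
      _ = _ := by ring
  have key' : ∀ x y, f₁ x * f₂ y + f₁ y * f₂ x ≤ f₃ x * f₄ y + f₃ y * f₄ x := by
    intro x y
    rcases le_total x y with hxy | hxy
    · exact key x y hxy
    · have := key y x hxy
      rwa [add_comm, add_comm (f₃ x * f₄ y)]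
  have expand : ∀ f g : ℝ → ℝ≥0∞, Measurable f → Measurable g →
      ∫⁻ x, ∫⁻ y, (f x * g y + f y * g x) = 2 * ((∫⁻ x, f x) * ∫⁻ x, g x) := by
    intro f g hf hg
    have : ∀ x, ∫⁻ y, (f x * g y + f y * g x) = f x * (∫⁻ y, g y) + (∫⁻ y, f y) * g x := by
      intro x
      rw [lintegral_add_left (by fun_prop), lintegral_const_mul _ hg, lintegral_mul_const _ hf]
    simp_rw [this]
    rw [lintegral_add_left (by fun_prop), lintegral_mul_const _ hf, lintegral_const_mul _ hg]
    ring
  have h2 := lintegral_mono (μ := volume) (fun x => lintegral_mono (μ := volume) (key' x))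
  rw [expand _ _ h₁ h₂, expand _ _ h₃ h₄] at h2
  exact (ENNReal.mul_le_mul_iff_right (by simp) (by simp)).1 h2

theorem lintegral_fin_succ {k : ℕ} {f : (Fin (k + 1) → ℝ) → ℝ≥0∞} (hf : Measurable f) :
    ∫⁻ x, f x = ∫⁻ t : ℝ, ∫⁻ z : Fin k → ℝ, f (Fin.cons t z) := by
  have e := (volume_preserving_piFinSuccAbove (fun _ : Fin (k + 1) => ℝ) 0).symm
  rw [← e.lintegral_comp hf, Measure.volume_eq_prod, lintegral_prod _ (by fun_prop)]
  refine lintegral_congr fun t => lintegral_congr fun z => ?_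
  congr 1
  exact Fin.insertNth_zero' t z

theorem measurable_cons_uncurry {k : ℕ} :
    Measurable (fun p : ℝ × (Fin k → ℝ) => (Fin.cons p.1 p.2 : Fin (k + 1) → ℝ)) := by
  refine measurable_pi_iff.2 fun i => ?_
  refine Fin.cases ?_ (fun i => ?_) i
  · simpa using measurable_fst
  · simp only [Fin.cons_succ]; fun_prop

/-- The continuous four functions theorem on `ℝᵏ`. -/
theorem four_functions_lintegral {k : ℕ} {f₁ f₂ f₃ f₄ : (Fin k → ℝ) → ℝ≥0∞}
    (h₁ : Measurable f₁) (h₂ : Measurable f₂) (h₃ : Measurable f₃) (h₄ : Measurable f₄)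
    (h : ∀ x y, f₁ x * f₂ y ≤ f₃ (x ⊔ y) * f₄ (x ⊓ y)) :
    (∫⁻ x, f₁ x) * ∫⁻ x, f₂ x ≤ (∫⁻ x, f₃ x) * ∫⁻ x, f₄ x := by
  induction k with
  | zero =>
    simp only [lintegral_unique]
    have hv : (volume : Measure (Fin 0 → ℝ)) Set.univ = 1 := by
      rw [volume_pi, Measure.pi_univ]; simp
    simp only [hv, mul_one]
    convert h default default using 2 <;> exact congrArg _ (Subsingleton.elim _ _)
  | succ k ih =>
    rw [lintegral_fin_succ h₁, lintegral_fin_succ h₂, lintegral_fin_succ h₃,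
      lintegral_fin_succ h₄]
    have hm : ∀ {f : (Fin (k + 1) → ℝ) → ℝ≥0∞}, Measurable f →
        Measurable (fun t : ℝ => ∫⁻ z : Fin k → ℝ, f (Fin.cons t z)) := fun hf =>
      (hf.comp measurable_cons_uncurry).lintegral_prod_right'
    refine four_functions_lintegral_real (hm h₁) (hm h₂) (hm h₃) (hm h₄) fun s t => ?_
    have hs : ∀ {f : (Fin (k + 1) → ℝ) → ℝ≥0∞} (t : ℝ), Measurable f →
        Measurable (fun z : Fin k → ℝ => f (Fin.cons t z)) := fun t hf =>
      hf.comp (measurable_cons_uncurry.comp (by fun_prop : Measurable fun z : Fin k → ℝ => (t, z)))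
    refine ih (hs s h₁) (hs t h₂) (hs (s ⊔ t) h₃) (hs (s ⊓ t) h₄) fun x y => ?_
    convert h (Fin.cons s x) (Fin.cons t y) using 3
    all_goals
      ext i
      refine Fin.cases ?_ (fun i => ?_) i <;> simp

/-- The `β`-th power of the positive part. -/
noncomputable def posPow (β t : ℝ) : ℝ := max t 0 ^ β

/-- The product of the `β`-th powers of the positive parts of all gaps; it is supported on
increasing configurations. -/
noncomputable def gapProd {m : ℕ} (β : ℝ) (y : Fin m → ℝ) : ℝ :=
  ∏ p ∈ Finset.univ.filter (fun p : Fin m × Fin m => p.1 < p.2), posPow β (y p.2 - y p.1)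

/-- The joint weight of the distances `y j = s - x j` of the other particles to the largest
particle, located at `s`. -/
noncomputable def edgeWeight {m : ℕ} (β c s : ℝ) (y : Fin m → ℝ) : ℝ :=
  gapProd β y * (∏ j, posPow β (y j)) * Real.exp (-c * ∑ j, (s - y j) ^ 2)

theorem posPow_nonneg (β t : ℝ) : 0 ≤ posPow β t := by unfold posPow; positivity

theorem posPow_of_nonpos {β t : ℝ} (hβ : 0 < β) (ht : t ≤ 0) : posPow β t = 0 := by
  rw [posPow, max_eq_right ht, Real.zero_rpow hβ.ne']

theorem posPow_of_pos {β t : ℝ} (ht : 0 < t) : posPow β t = t ^ β := by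
  rw [posPow, max_eq_left ht.le]

theorem continuous_posPow {β : ℝ} (hβ : 0 ≤ β) : Continuous (posPow β) :=
  (continuous_id.max continuous_const).rpow_const fun _ => Or.inr hβ

theorem posPow_le_exp {β : ℝ} (hβ : 0 ≤ β) (t : ℝ) : posPow β t ≤ Real.exp (β * |t|) := by
  have h : max t 0 ≤ Real.exp |t| :=
    max_le ((le_abs_self t).trans (by linarith [Real.add_one_le_exp |t|])) (Real.exp_pos _).le
  calc posPow β t ≤ Real.exp |t| ^ β := Real.rpow_le_rpow (le_max_right _ _) h hβ
    _ = _ := by rw [← Real.exp_mul, mul_comm]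

theorem posPow_mul_abs_inv_le_exp {β : ℝ} (hβ : 1 ≤ β) (t : ℝ) :
    posPow β t * |t⁻¹| ≤ Real.exp (β * |t|) := by
  rcases le_or_gt t 0 with ht | ht
  · rw [posPow_of_nonpos (by linarith) ht, zero_mul]; positivity
  · have : posPow β t * |t⁻¹| = posPow (β - 1) t := by
      rw [posPow_of_pos ht, posPow_of_pos ht, Real.rpow_sub_one ht.ne', abs_of_pos (inv_pos.2 ht),
        div_eq_mul_inv]
    rw [this]
    refine (posPow_le_exp (by linarith) t).trans (Real.exp_le_exp.2 ?_)
    nlinarith [abs_nonneg t]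

theorem gapProd_nonneg {m : ℕ} (β : ℝ) (y : Fin m → ℝ) : 0 ≤ gapProd β y :=
  Finset.prod_nonneg fun _ _ => posPow_nonneg _ _

theorem edgeWeight_nonneg {m : ℕ} (β c s : ℝ) (y : Fin m → ℝ) : 0 ≤ edgeWeight β c s y :=
  mul_nonneg (mul_nonneg (gapProd_nonneg _ _) (Finset.prod_nonneg fun _ _ => posPow_nonneg _ _))
    (Real.exp_pos _).le

theorem continuous_gapProd {m : ℕ} {β : ℝ} (hβ : 0 ≤ β) :
    Continuous (gapProd β : (Fin m → ℝ) → ℝ) :=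
  continuous_finsetProd _ fun p _ => (continuous_posPow hβ).comp (by fun_prop)

theorem continuous_edgeWeight {m : ℕ} {β : ℝ} (hβ : 0 ≤ β) (c s : ℝ) :
    Continuous (edgeWeight β c s : (Fin m → ℝ) → ℝ) :=
  ((continuous_gapProd hβ).mul
    (continuous_finsetProd _ fun j _ => (continuous_posPow hβ).comp (by fun_prop))).mul
    (by fun_prop)

theorem prod_mul_le_prod {ι : Type*} {S : Finset ι} {f e : ι → ℝ} {i : ι} {g : ℝ}
    (hi : i ∈ S) (hf : ∀ k ∈ S, 0 ≤ f k) (hfe : ∀ k ∈ S, f k ≤ e k) (hg : 0 ≤ f i * g)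
    (hge : f i * g ≤ e i) :
    (∏ k ∈ S, f k) * g ≤ ∏ k ∈ S, e k := by
  classical
  rw [← Finset.mul_prod_erase S f hi, ← Finset.mul_prod_erase S e hi, mul_right_comm]
  refine mul_le_mul hge (Finset.prod_le_prod (fun k hk => hf k (Finset.mem_of_mem_erase hk))
    fun k hk => hfe k (Finset.mem_of_mem_erase hk))
    (Finset.prod_nonneg fun k hk => hf k (Finset.mem_of_mem_erase hk)) (hg.trans hge)

theorem prod_exp_gap_le {m : ℕ} {β : ℝ} (hβ : 0 ≤ β) (y : Fin m → ℝ) :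
    ∏ p ∈ Finset.univ.filter (fun p : Fin m × Fin m => p.1 < p.2),
      Real.exp (β * |y p.2 - y p.1|) ≤ Real.exp (2 * m * β * ∑ j, |y j|) := by
  rw [← Real.exp_sum, Real.exp_le_exp]
  calc ∑ p ∈ Finset.univ.filter (fun p : Fin m × Fin m => p.1 < p.2), β * |y p.2 - y p.1|
      ≤ ∑ p : Fin m × Fin m, β * |y p.2 - y p.1| :=
        Finset.sum_le_sum_of_subset_of_nonneg (Finset.filter_subset _ _)
          fun _ _ _ => by positivity
    _ ≤ ∑ p : Fin m × Fin m, β * (|y p.2| + |y p.1|) :=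
        Finset.sum_le_sum fun p _ => by gcongr; exact abs_sub _ _
    _ = 2 * m * β * ∑ j, |y j| := by
        rw [← Finset.mul_sum, Fintype.sum_prod_type]
        simp only [Finset.sum_add_distrib, Finset.sum_const, Finset.card_univ, Fintype.card_fin,
          nsmul_eq_mul, ← Finset.mul_sum]
        ring

theorem gapProd_le {m : ℕ} {β : ℝ} (hβ : 0 ≤ β) (y : Fin m → ℝ) :
    gapProd β y ≤ Real.exp (2 * m * β * ∑ j, |y j|) :=
  (Finset.prod_le_prod (fun _ _ => posPow_nonneg _ _) fun _ _ => posPow_le_exp hβ _).trans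
    (prod_exp_gap_le hβ y)

theorem gapProd_mul_abs_inv_le {m : ℕ} {β : ℝ} (hβ : 1 ≤ β) (y : Fin m → ℝ) (i j : Fin m) :
    gapProd β y * |(y i - y j)⁻¹| ≤ Real.exp (2 * m * β * ∑ j, |y j|) := by
  have key : ∀ i j : Fin m, i < j →
      gapProd β y * |(y j - y i)⁻¹| ≤ Real.exp (2 * m * β * ∑ j, |y j|) := fun i j hij =>
    (prod_mul_le_prod (i := (i, j)) (by simpa using hij) (fun _ _ => posPow_nonneg _ _)
      (fun _ _ => posPow_le_exp (by linarith) _)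
      (mul_nonneg (posPow_nonneg _ _) (abs_nonneg _))
      (posPow_mul_abs_inv_le_exp hβ _)).trans (prod_exp_gap_le (by linarith) y)
  rcases lt_trichotomy i j with h | rfl | h
  · have := key i j h
    rwa [← abs_neg, ← inv_neg, neg_sub] at this
  · simp; positivity
  · exact key j i h

/-- The integrable majorant used throughout. -/
noncomputable def majorant {m : ℕ} (K c s : ℝ) (y : Fin m → ℝ) : ℝ :=
  Real.exp (K * ∑ j, |y j| - c * ∑ j, (s - y j) ^ 2)

theorem linear_sub_quadratic_le {c : ℝ} (hc : 0 < c) (K s : ℝ) :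
    ∃ B : ℝ, ∀ t : ℝ, K * |t| - c * (s - t) ^ 2 ≤ B - c / 2 * t ^ 2 := by
  refine ⟨(|K| + 2 * c * |s|) ^ 2 / (2 * c), fun t => ?_⟩
  have h1 : K * |t| ≤ |K| * |t| := by gcongr; exact le_abs_self K
  have h2 : s * t ≤ |s| * |t| := by rw [← abs_mul]; exact le_abs_self _
  have h3 : (|K| + 2 * c * |s|) ^ 2 / (2 * c) =
      (|K| + 2 * c * |s|) * |t| - c / 2 * |t| ^ 2
        + (|K| + 2 * c * |s| - c * |t|) ^ 2 / (2 * c) := by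
    field_simp; ring
  have h4 : 0 ≤ (|K| + 2 * c * |s| - c * |t|) ^ 2 / (2 * c) := by positivity
  have h5 : |t| ^ 2 = t ^ 2 := sq_abs t
  nlinarith [sq_nonneg s]

theorem integrable_majorant {m : ℕ} {c : ℝ} (hc : 0 < c) (K s : ℝ) :
    Integrable (majorant K c s : (Fin m → ℝ) → ℝ) := by
  obtain ⟨B, hB⟩ := linear_sub_quadratic_le hc K s
  have h1 : Integrable (fun t : ℝ => Real.exp (K * |t| - c * (s - t) ^ 2)) := by
    refine ((integrable_exp_neg_mul_sq (half_pos hc)).const_mul (Real.exp B)).mono'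
      (by fun_prop) (Eventually.of_forall fun t => ?_)
    rw [Real.norm_eq_abs, Real.abs_exp, ← Real.exp_add, Real.exp_le_exp]
    linarith [hB t]
  have h2 := Integrable.fintype_prod (μ := fun _ : Fin m => volume) (fun _ => h1)
  refine h2.congr (Eventually.of_forall fun y => ?_)
  simp only [majorant, ← Real.exp_sum, Finset.sum_sub_distrib, Finset.mul_sum]

theorem prod_posPow_le {m : ℕ} {β : ℝ} (hβ : 0 ≤ β) (y : Fin m → ℝ) :
    ∏ j, posPow β (y j) ≤ Real.exp (β * ∑ j, |y j|) := by
  rw [Finset.mul_sum, Real.exp_sum]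
  exact Finset.prod_le_prod (fun _ _ => posPow_nonneg _ _) fun _ _ => posPow_le_exp hβ _

theorem prod_posPow_mul_abs_inv_le {m : ℕ} {β : ℝ} (hβ : 1 ≤ β) (y : Fin m → ℝ) (i : Fin m) :
    (∏ j, posPow β (y j)) * |(y i)⁻¹| ≤ Real.exp (β * ∑ j, |y j|) := by
  rw [Finset.mul_sum, Real.exp_sum]
  exact prod_mul_le_prod (Finset.mem_univ i) (fun _ _ => posPow_nonneg _ _)
    (fun _ _ => posPow_le_exp (by linarith) _)
    (mul_nonneg (posPow_nonneg _ _) (abs_nonneg _)) (posPow_mul_abs_inv_le_exp hβ _)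

theorem majorant_eq {m : ℕ} (β c s : ℝ) (y : Fin m → ℝ) :
    majorant ((2 * m + 1) * β) c s y = Real.exp (2 * m * β * ∑ j, |y j|) *
      Real.exp (β * ∑ j, |y j|) * Real.exp (-c * ∑ j, (s - y j) ^ 2) := by
  rw [majorant, ← Real.exp_add, ← Real.exp_add]
  congr 1; ring

theorem edgeWeight_le {m : ℕ} {β : ℝ} (hβ : 0 ≤ β) (c s : ℝ) (y : Fin m → ℝ) :
    edgeWeight β c s y ≤ majorant ((2 * m + 1) * β) c s y := by
  rw [majorant_eq, edgeWeight]
  gcongr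
  · exact Finset.prod_nonneg fun _ _ => posPow_nonneg _ _
  · exact gapProd_le hβ y
  · exact prod_posPow_le hβ y

theorem edgeWeight_mul_abs_inv_sub_le {m : ℕ} {β : ℝ} (hβ : 1 ≤ β) (c s : ℝ) (y : Fin m → ℝ)
    (i j : Fin m) :
    edgeWeight β c s y * |(y i - y j)⁻¹| ≤ majorant ((2 * m + 1) * β) c s y := by
  have : edgeWeight β c s y * |(y i - y j)⁻¹| = gapProd β y * |(y i - y j)⁻¹| *
      (∏ j, posPow β (y j)) * Real.exp (-c * ∑ j, (s - y j) ^ 2) := by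
    rw [edgeWeight]; ring
  rw [majorant_eq, this]
  gcongr
  · exact Finset.prod_nonneg fun _ _ => posPow_nonneg _ _
  · exact gapProd_mul_abs_inv_le hβ y i j
  · exact prod_posPow_le (by linarith) y

theorem edgeWeight_mul_abs_inv_le {m : ℕ} {β : ℝ} (hβ : 1 ≤ β) (c s : ℝ) (y : Fin m → ℝ)
    (i : Fin m) :
    edgeWeight β c s y * |(y i)⁻¹| ≤ majorant ((2 * m + 1) * β) c s y := by
  have : edgeWeight β c s y * |(y i)⁻¹| = gapProd β y *
      ((∏ j, posPow β (y j)) * |(y i)⁻¹|) * Real.exp (-c * ∑ j, (s - y j) ^ 2) := by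
    rw [edgeWeight]; ring
  rw [majorant_eq, this]
  gcongr
  · exact mul_nonneg (Finset.prod_nonneg fun _ _ => posPow_nonneg _ _) (abs_nonneg _)
  · exact gapProd_le (by linarith) y
  · exact prod_posPow_mul_abs_inv_le hβ y i

theorem edgeWeight_mul_abs_sub_le {m : ℕ} {β : ℝ} (hβ : 0 ≤ β) (c s : ℝ) (y : Fin m → ℝ)
    (i : Fin m) :
    edgeWeight β c s y * |s - y i| ≤
      Real.exp |s| * majorant ((2 * m + 1) * β + 1) c s y := by
  have h1 : |s - y i| ≤ Real.exp (|s| + ∑ j, |y j|) := by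
    have := Finset.single_le_sum (f := fun j => |y j|) (fun j _ => abs_nonneg _)
      (Finset.mem_univ i)
    have h2 := abs_sub s (y i)
    have h3 := Real.add_one_le_exp (|s| + ∑ j, |y j|)
    linarith
  calc edgeWeight β c s y * |s - y i|
      ≤ majorant ((2 * m + 1) * β) c s y * Real.exp (|s| + ∑ j, |y j|) := by
        gcongr
        · exact (Real.exp_pos _).le
        · exact edgeWeight_le hβ c s y
    _ = _ := by
        simp only [majorant, ← Real.exp_add]
        congr 1; ring

theorem integrable_edgeWeight {m : ℕ} {β c : ℝ} (hβ : 0 ≤ β) (hc : 0 < c) (s : ℝ) :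
    Integrable (edgeWeight β c s : (Fin m → ℝ) → ℝ) :=
  (integrable_majorant hc _ s).mono' (continuous_edgeWeight hβ c s).aestronglyMeasurable
    (Eventually.of_forall fun y => by
      rw [Real.norm_eq_abs, abs_of_nonneg (edgeWeight_nonneg _ _ _ _)]
      exact edgeWeight_le hβ c s y)

theorem integrable_edgeWeight_mul_inv_sub {m : ℕ} {β c : ℝ} (hβ : 1 ≤ β) (hc : 0 < c) (s : ℝ)
    (i j : Fin m) :
    Integrable (fun y : Fin m → ℝ => edgeWeight β c s y * (y i - y j)⁻¹) :=
  (integrable_majorant hc _ s).mono'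
    ((continuous_edgeWeight (by linarith) c s).measurable.mul
      (by fun_prop)).aestronglyMeasurable
    (Eventually.of_forall fun y => by
      rw [Real.norm_eq_abs, abs_mul, abs_of_nonneg (edgeWeight_nonneg _ _ _ _)]
      exact edgeWeight_mul_abs_inv_sub_le hβ c s y i j)

theorem integrable_edgeWeight_mul_inv {m : ℕ} {β c : ℝ} (hβ : 1 ≤ β) (hc : 0 < c) (s : ℝ)
    (i : Fin m) :
    Integrable (fun y : Fin m → ℝ => edgeWeight β c s y * (y i)⁻¹) :=
  (integrable_majorant hc _ s).mono'
    ((continuous_edgeWeight (by linarith) c s).measurable.mul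
      (by fun_prop)).aestronglyMeasurable
    (Eventually.of_forall fun y => by
      rw [Real.norm_eq_abs, abs_mul, abs_of_nonneg (edgeWeight_nonneg _ _ _ _)]
      exact edgeWeight_mul_abs_inv_le hβ c s y i)

theorem integrable_edgeWeight_mul_sub {m : ℕ} {β c : ℝ} (hβ : 0 ≤ β) (hc : 0 < c) (s : ℝ)
    (i : Fin m) :
    Integrable (fun y : Fin m → ℝ => edgeWeight β c s y * (s - y i)) :=
  ((integrable_majorant hc _ s).const_mul _).mono'
    ((continuous_edgeWeight hβ c s).mul (by fun_prop)).aestronglyMeasurable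
    (Eventually.of_forall fun y => by
      rw [Real.norm_eq_abs, abs_mul, abs_of_nonneg (edgeWeight_nonneg _ _ _ _)]
      exact edgeWeight_mul_abs_sub_le hβ c s y i)

theorem sum_lt_add_swap {m : ℕ} (h : Fin m → Fin m → ℝ) (h0 : ∀ a, h a a = 0) :
    ∑ p ∈ Finset.univ.filter (fun p : Fin m × Fin m => p.1 < p.2), (h p.1 p.2 + h p.2 p.1) =
      ∑ a, ∑ b, h a b := by
  rw [← Fintype.sum_prod_type', ← Finset.sum_filter_add_sum_filter_not Finset.univ
    (fun p : Fin m × Fin m => p.1 < p.2), Finset.sum_add_distrib]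
  congr 1
  rw [← Finset.sum_filter_add_sum_filter_not (Finset.univ.filter fun p : Fin m × Fin m =>
    ¬ p.1 < p.2) (fun p => p.1 = p.2)]
  have : ∑ p ∈ (Finset.univ.filter fun p : Fin m × Fin m => ¬ p.1 < p.2).filter
      (fun p => p.1 = p.2), h p.1 p.2 = 0 := by
    refine Finset.sum_eq_zero fun p hp => ?_
    rw [(Finset.mem_filter.1 hp).2, h0]
  rw [this, zero_add]
  refine Finset.sum_bij' (fun p _ => p.swap) (fun p _ => p.swap) ?_ ?_ ?_ ?_ ?_ <;>
    simp +contextual [Prod.swap]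
  · intro a b hab; exact ⟨hab.le, hab.ne'⟩
  · intro a b hab hne; exact lt_of_le_of_ne hab (Ne.symm hne)

/-- The logarithmic derivative of `edgeWeight` in the `j`-th coordinate. -/
noncomputable def edgeScore {m : ℕ} (β c s : ℝ) (y : Fin m → ℝ) (j : Fin m) : ℝ :=
  β * ∑ i, (y j - y i)⁻¹ + β * (y j)⁻¹ + 2 * c * (s - y j)

theorem edgeWeight_eq_exp {m : ℕ} (β c s : ℝ) {y : Fin m → ℝ}
    (h1 : ∀ p : Fin m × Fin m, p.1 < p.2 → 0 < y p.2 - y p.1) (h2 : ∀ j, 0 < y j) :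
    edgeWeight β c s y = Real.exp
      (∑ p ∈ Finset.univ.filter (fun p : Fin m × Fin m => p.1 < p.2),
        β * Real.log (y p.2 - y p.1) + ∑ j, β * Real.log (y j) + -c * ∑ j, (s - y j) ^ 2) := by
  rw [Real.exp_add, Real.exp_add, Real.exp_sum, Real.exp_sum, edgeWeight, gapProd]
  congr 2
  · refine Finset.prod_congr rfl fun p hp => ?_
    have := h1 p (by simpa using hp)
    rw [posPow_of_pos this, Real.rpow_def_of_pos this, mul_comm]
  · refine Finset.prod_congr rfl fun j _ => ?_
    rw [posPow_of_pos (h2 j), Real.rpow_def_of_pos (h2 j), mul_comm]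

theorem edgeWeight_eq_zero_of_gap {m : ℕ} {β : ℝ} (hβ : 0 < β) (c s : ℝ) {y : Fin m → ℝ}
    {p : Fin m × Fin m} (hp : p.1 < p.2) (h : y p.2 - y p.1 ≤ 0) : edgeWeight β c s y = 0 := by
  rw [edgeWeight, gapProd, Finset.prod_eq_zero (i := p) (by simpa using hp)
    (posPow_of_nonpos hβ h), zero_mul, zero_mul]

theorem edgeWeight_eq_zero_of_nonpos {m : ℕ} {β : ℝ} (hβ : 0 < β) (c s : ℝ) {y : Fin m → ℝ}
    {j : Fin m} (h : y j ≤ 0) : edgeWeight β c s y = 0 := by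
  rw [edgeWeight, Finset.prod_eq_zero (Finset.mem_univ j) (posPow_of_nonpos hβ h), mul_zero,
    zero_mul]

theorem sum_gap_log_deriv {m : ℕ} (y : Fin m → ℝ) (j : Fin m) :
    ∑ p ∈ Finset.univ.filter (fun p : Fin m × Fin m => p.1 < p.2),
      ((Pi.single j 1 : Fin m → ℝ) p.2 - (Pi.single j 1 : Fin m → ℝ) p.1) / (y p.2 - y p.1) =
      ∑ i, (y j - y i)⁻¹ := by
  have := sum_lt_add_swap (fun a b => (Pi.single j 1 : Fin m → ℝ) a * (y a - y b)⁻¹) (by simp)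
  rw [Finset.sum_eq_single j (fun a _ ha => by simp [ha]) (by simp)] at this
  simp only [Pi.single_eq_same, one_mul] at this
  rw [← this]
  refine Finset.sum_congr rfl fun p _ => ?_
  rw [← neg_sub (y p.2) (y p.1), inv_neg]
  ring

theorem hasDerivAt_edgeWeight_update_self {m : ℕ} {β : ℝ} (hβ : 0 < β) (c s : ℝ)
    {z : Fin m → ℝ} {j : Fin m} (h0 : z j ≠ 0) (hz : ∀ i, i ≠ j → z i ≠ z j) :
    HasDerivAt (fun u => edgeWeight β c s (Function.update z j u))
      (edgeWeight β c s z * edgeScore β c s z j) (z j) := by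
  have hu : ∀ k, HasDerivAt (fun u => Function.update z j u k) ((Pi.single j 1 : Fin m → ℝ) k)
      (z j) := hasDerivAt_pi.1 (hasDerivAt_update z j (z j))
  have hcont : ∀ k, ContinuousAt (fun u => Function.update z j u k) (z j) := fun k =>
    (hu k).continuousAt
  by_cases hch : (∀ p : Fin m × Fin m, p.1 < p.2 → 0 < z p.2 - z p.1) ∧ ∀ k, 0 < z k
  · obtain ⟨h1, h2⟩ := hch
    have ev : ∀ᶠ u in 𝓝 (z j), edgeWeight β c s (Function.update z j u) = Real.exp
      (∑ p ∈ Finset.univ.filter (fun p : Fin m × Fin m => p.1 < p.2),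
        β * Real.log (Function.update z j u p.2 - Function.update z j u p.1)
        + ∑ k, β * Real.log (Function.update z j u k)
        + -c * ∑ k, (s - Function.update z j u k) ^ 2) := by
      have e1 : ∀ᶠ u in 𝓝 (z j), ∀ p : Fin m × Fin m, p.1 < p.2 →
          0 < Function.update z j u p.2 - Function.update z j u p.1 := by
        refine eventually_all.2 fun p => ?_
        by_cases hp : p.1 < p.2
        · have : ContinuousAt (fun u => Function.update z j u p.2 - Function.update z j u p.1)
            (z j) := (hcont p.2).sub (hcont p.1)
          have := this.eventually (lt_mem_nhds (a := 0) (by simpa using h1 p hp))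
          filter_upwards [this] with u hu _ using hu
        · exact Eventually.of_forall fun _ h => absurd h hp
      have e2 : ∀ᶠ u in 𝓝 (z j), ∀ k, 0 < Function.update z j u k :=
        eventually_all.2 fun k =>
          (hcont k).eventually (lt_mem_nhds (a := 0) (by simpa using h2 k))
      filter_upwards [e1, e2] with u hu1 hu2 using edgeWeight_eq_exp β c s hu1 hu2
    refine HasDerivAt.congr_of_eventuallyEq ?_ ev
    rw [edgeWeight_eq_exp β c s h1 h2]
    have d1 := HasDerivAt.fun_sum (u := Finset.univ.filter fun p : Fin m × Fin m => p.1 < p.2)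
      (A := fun p u => β * Real.log (Function.update z j u p.2 - Function.update z j u p.1))
      (fun p hp => (((hu p.2).sub (hu p.1)).log (by
        simpa using (h1 p (by simpa using hp)).ne')).const_mul β)
    have d2 := HasDerivAt.fun_sum (u := Finset.univ)
      (A := fun k u => β * Real.log (Function.update z j u k))
      (fun k _ => ((hu k).log (by simpa using (h2 k).ne')).const_mul β)
    have d3 := (HasDerivAt.fun_sum (u := Finset.univ)
      (A := fun k u => (s - Function.update z j u k) ^ 2)
      (fun k _ => ((hu k).const_sub s).pow 2)).const_mul (-c)
    have d := ((d1.add d2).add d3).exp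
    refine HasDerivAt.congr_deriv d ?_
    simp only [Pi.add_apply, Function.update_eq_self, Pi.sub_apply]
    congr 1
    rw [← Finset.mul_sum, sum_gap_log_deriv, ← Finset.mul_sum, edgeScore]
    congr 1
    · congr 2
      rw [Finset.sum_eq_single j (fun a _ ha => by simp [ha]) (by simp)]
      simp
    · rw [Finset.sum_eq_single j (fun a _ ha => by simp [ha]) (by simp)]
      simp; ring
  · have hzero : ∀ᶠ u in 𝓝 (z j), edgeWeight β c s (Function.update z j u) = 0 := by
      rw [not_and_or] at hch
      rcases hch with h | h
      · push Not at h
        obtain ⟨p, hp, hle⟩ := h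
        by_cases hpj : p.1 = j ∨ p.2 = j
        · have hne : z p.2 - z p.1 ≠ 0 := by
            rcases hpj with rfl | rfl
            · exact sub_ne_zero.2 (hz _ hp.ne')
            · exact sub_ne_zero.2 (hz _ hp.ne).symm
          have : ContinuousAt (fun u => Function.update z j u p.2 - Function.update z j u p.1)
            (z j) := (hcont p.2).sub (hcont p.1)
          have := this.tendsto.eventually_lt_const (u := 0)
            (by simpa using lt_of_le_of_ne hle hne)
          filter_upwards [this] with u hu
            using edgeWeight_eq_zero_of_gap hβ c s hp hu.le
        · push Not at hpj
          refine Eventually.of_forall fun u => edgeWeight_eq_zero_of_gap hβ c s hp ?_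
          rwa [Function.update_of_ne hpj.1, Function.update_of_ne hpj.2]
      · push Not at h
        obtain ⟨k, hk⟩ := h
        by_cases hkj : k = j
        · subst hkj
          have := (hcont k).tendsto.eventually_lt_const (u := 0)
            (by simpa using lt_of_le_of_ne hk h0)
          filter_upwards [this] with u hu
            using edgeWeight_eq_zero_of_nonpos hβ c s (j := k) hu.le
        · refine Eventually.of_forall fun u => edgeWeight_eq_zero_of_nonpos hβ c s (j := k) ?_
          rwa [Function.update_of_ne hkj]
    have hz0 : edgeWeight β c s z = 0 := by simpa using hzero.self_of_nhds
    rw [hz0, zero_mul]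
    exact (hasDerivAt_const (z j) (0 : ℝ)).congr_of_eventuallyEq hzero

theorem integral_eq_zero_of_hasDerivAt_off_countable {f f' : ℝ → ℝ} {S : Set ℝ}
    (hS : S.Countable) (hf : Continuous f) (hd : ∀ t, t ∉ S → HasDerivAt f (f' t) t)
    (hi : Integrable f') (h₁ : Tendsto f atTop (𝓝 0)) (h₂ : Tendsto f atBot (𝓝 0)) :
    ∫ t, f' t = 0 := by
  have e1 : ∀ n : ℕ, ∫ t in (-(n : ℝ))..n, f' t = f n - f (-(n : ℝ)) := fun n => by
    refine MeasureTheory.integral_eq_of_hasDerivAt_off_countable f f' hS hf.continuousOn ?_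
      hi.intervalIntegrable
    intro x hx
    exact hd x hx.2
  have e2 := intervalIntegral_tendsto_integral hi (tendsto_neg_atTop_atBot.comp
    (tendsto_natCast_atTop_atTop (R := ℝ))) (tendsto_natCast_atTop_atTop (R := ℝ))
  simp only [Function.comp_apply, e1] at e2
  have e3 : Tendsto (fun n : ℕ => f n - f (-(n : ℝ))) atTop (𝓝 (0 - 0)) :=
    (h₁.comp tendsto_natCast_atTop_atTop).sub
      (h₂.comp (tendsto_neg_atTop_atBot.comp tendsto_natCast_atTop_atTop))
  rw [sub_zero] at e3
  exact tendsto_nhds_unique e2 e3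

theorem integrable_edgeWeight_mul_edgeScore {m : ℕ} {β c : ℝ} (hβ : 1 ≤ β) (hc : 0 < c) (s : ℝ)
    (j : Fin m) :
    Integrable (fun y : Fin m → ℝ => edgeWeight β c s y * edgeScore β c s y j) := by
  have h1 := (integrable_finsetSum Finset.univ fun i _ =>
    integrable_edgeWeight_mul_inv_sub hβ hc s j i).const_mul β
  have h2 := (integrable_edgeWeight_mul_inv hβ hc s j).const_mul β
  have h3 := (integrable_edgeWeight_mul_sub (by linarith : (0 : ℝ) ≤ β) hc s j).const_mul (2 * c)
  refine ((h1.add h2).add h3).congr (Eventually.of_forall fun y => ?_)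
  simp only [Pi.add_apply, edgeScore, ← Finset.mul_sum]
  ring

theorem majorant_insertNth {k : ℕ} (K c s : ℝ) (j : Fin (k + 1)) (t : ℝ) (z : Fin k → ℝ) :
    majorant K c s (j.insertNth t z : Fin (k + 1) → ℝ) =
      Real.exp (K * |t| - c * (s - t) ^ 2) * majorant K c s z := by
  simp only [majorant, ← Real.exp_add, Fin.sum_univ_succAbove _ j, Fin.insertNth_apply_same,
    Fin.insertNth_apply_succAbove]
  congr 1; ring

theorem tendsto_exp_linear_sub_quadratic {c : ℝ} (hc : 0 < c) (K s : ℝ) {l : Filter ℝ}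
    (hl : Tendsto (fun t : ℝ => |t|) l atTop) :
    Tendsto (fun t : ℝ => Real.exp (K * |t| - c * (s - t) ^ 2)) l (𝓝 0) := by
  obtain ⟨B, hB⟩ := linear_sub_quadratic_le hc K s
  refine Real.tendsto_exp_atBot.comp (tendsto_atBot_mono hB ?_)
  have h1 : Tendsto (fun t : ℝ => c / 2 * |t| ^ 2) l atTop :=
    ((tendsto_pow_atTop two_ne_zero).comp hl).const_mul_atTop (half_pos hc)
  simp only [sq_abs] at h1
  exact tendsto_atBot_add_const_left _ B (tendsto_neg_atTop_atBot.comp h1)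

/-- The loop equation: integration by parts in one coordinate. -/
theorem integral_edgeWeight_mul_deriv_add {m : ℕ} {β c : ℝ} (hβ : 1 ≤ β) (hc : 0 < c) (s : ℝ)
    {φ φ' : ℝ → ℝ} {M : ℝ} (hφ : Continuous φ) (hM : ∀ t, |φ t| ≤ M) (hφ' : Measurable φ')
    (hM' : ∀ t, |φ' t| ≤ M) (hd : ∀ t, t ≠ 0 → HasDerivAt φ (φ' t) t) (j : Fin m) :
    Integrable (fun y : Fin m → ℝ => edgeWeight β c s y * φ' (y j)) ∧
    Integrable (fun y : Fin m → ℝ => φ (y j) * (edgeWeight β c s y * edgeScore β c s y j)) ∧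
    ∫ y : Fin m → ℝ, (edgeWeight β c s y * φ' (y j) +
      φ (y j) * (edgeWeight β c s y * edgeScore β c s y j)) = 0 := by
  have hβ0 : 0 < β := by linarith
  have i1 : Integrable (fun y : Fin m → ℝ => edgeWeight β c s y * φ' (y j)) :=
    (integrable_edgeWeight hβ0.le hc s).mul_bdd (c := M)
      (hφ'.comp (measurable_pi_apply j)).aestronglyMeasurable
      (Eventually.of_forall fun y => hM' _)
  have i2 : Integrable (fun y : Fin m → ℝ =>
      φ (y j) * (edgeWeight β c s y * edgeScore β c s y j)) :=
    (integrable_edgeWeight_mul_edgeScore hβ hc s j).bdd_mul (c := M)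
      (hφ.comp (continuous_apply j)).aestronglyMeasurable
      (Eventually.of_forall fun y => hM _)
  refine ⟨i1, i2, ?_⟩
  have hint := i1.add i2
  obtain _ | k := m
  · exact j.elim0
  have e := (volume_preserving_piFinSuccAbove (fun _ : Fin (k + 1) => ℝ) j).symm
  rw [← e.integral_comp']
  have hint' := (e.integrable_comp_emb (MeasurableEquiv.measurableEmbedding _)).2 hint
  rw [Measure.volume_eq_prod] at hint' ⊢
  refine (integral_prod_symm _ hint').trans ?_
  refine integral_eq_zero_of_ae (Eventually.of_forall fun z => ?_)
  by_cases hi : Integrable (fun t : ℝ =>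
      (fun y : Fin (k + 1) → ℝ => edgeWeight β c s y * φ' (y j) +
        φ (y j) * (edgeWeight β c s y * edgeScore β c s y j)) (j.insertNth t z))
  swap
  · exact integral_undef hi
  have hw : Continuous fun t : ℝ => (j.insertNth t z : Fin (k + 1) → ℝ) :=
    Continuous.finInsertNth j continuous_id continuous_const
  have hbound : ∀ t : ℝ, ‖φ t * edgeWeight β c s (j.insertNth t z : Fin (k + 1) → ℝ)‖ ≤
      (M * majorant ((2 * (k + 1 : ℕ) + 1) * β) c s z) *
        Real.exp ((2 * (k + 1 : ℕ) + 1) * β * |t| - c * (s - t) ^ 2) := by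
    intro t
    rw [norm_mul, Real.norm_eq_abs, Real.norm_eq_abs, abs_of_nonneg (edgeWeight_nonneg _ _ _ _)]
    calc |φ t| * edgeWeight β c s (j.insertNth t z : Fin (k + 1) → ℝ)
        ≤ M * majorant ((2 * (k + 1 : ℕ) + 1) * β) c s (j.insertNth t z : Fin (k + 1) → ℝ) :=
          mul_le_mul (hM t) (edgeWeight_le hβ0.le c s _) (edgeWeight_nonneg _ _ _ _)
            ((abs_nonneg _).trans (hM t))
      _ = _ := by rw [majorant_insertNth]; ring
  have hlim : ∀ l : Filter ℝ, Tendsto (fun t : ℝ => |t|) l atTop →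
      Tendsto (fun t : ℝ => φ t * edgeWeight β c s (j.insertNth t z : Fin (k + 1) → ℝ)) l
        (𝓝 0) := fun l hl => by
    refine squeeze_zero_norm hbound ?_
    simpa using (tendsto_exp_linear_sub_quadratic hc ((2 * (k + 1 : ℕ) + 1) * β) s hl).const_mul
      (M * majorant ((2 * (k + 1 : ℕ) + 1) * β) c s z)
  refine integral_eq_zero_of_hasDerivAt_off_countable
    (f := fun t => φ t * edgeWeight β c s (j.insertNth t z : Fin (k + 1) → ℝ))
    (S := insert 0 (Set.range z)) ((Set.countable_range z).insert 0)
    (hφ.mul ((continuous_edgeWeight hβ0.le c s).comp hw)) ?_ hi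
    (hlim _ tendsto_abs_atTop_atTop) (hlim _ tendsto_abs_atBot_atTop)
  intro t ht
  rw [Set.mem_insert_iff, not_or] at ht
  have hz : ∀ i, i ≠ j → (j.insertNth t z : Fin (k + 1) → ℝ) i ≠
      (j.insertNth t z : Fin (k + 1) → ℝ) j := by
    intro i hi
    obtain ⟨i', rfl⟩ := Fin.exists_succAbove_eq hi
    rw [Fin.insertNth_apply_succAbove, Fin.insertNth_apply_same]
    exact fun h => ht.2 ⟨i', h⟩
  have hder := hasDerivAt_edgeWeight_update_self hβ0 c s
    (z := (j.insertNth t z : Fin (k + 1) → ℝ)) (j := j)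
    (by rw [Fin.insertNth_apply_same]; exact ht.1) hz
  simp only [Fin.update_insertNth, Fin.insertNth_apply_same] at hder
  refine ((hd t ht.1).mul hder).congr_deriv ?_
  change _ = edgeWeight β c s (j.insertNth t z : Fin (k + 1) → ℝ) *
    φ' ((j.insertNth t z : Fin (k + 1) → ℝ) j) + φ ((j.insertNth t z : Fin (k + 1) → ℝ) j) *
      (edgeWeight β c s (j.insertNth t z : Fin (k + 1) → ℝ) *
        edgeScore β c s (j.insertNth t z : Fin (k + 1) → ℝ) j)
  rw [Fin.insertNth_apply_same, mul_comm (φ' t)]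

theorem posPow_mul_posPow_le {β : ℝ} (hβ : 0 < β) {p q u v : ℝ} (hu : p ≤ u) (hv : p ≤ v)
    (h : u + v = p + q) : posPow β p * posPow β q ≤ posPow β u * posPow β v := by
  rcases le_or_gt p 0 with hp | hp
  · rw [posPow_of_nonpos hβ hp, zero_mul]
    exact mul_nonneg (posPow_nonneg _ _) (posPow_nonneg _ _)
  · rw [posPow_of_pos hp, posPow_of_pos (by linarith : 0 < q), posPow_of_pos (by linarith : 0 < u),
      posPow_of_pos (by linarith : 0 < v), ← Real.mul_rpow (by linarith) (by linarith),
      ← Real.mul_rpow (by linarith) (by linarith)]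
    refine Real.rpow_le_rpow (by nlinarith) ?_ hβ.le
    obtain rfl : q = u + v - p := by linarith
    nlinarith [mul_nonneg (sub_nonneg.2 hu) (sub_nonneg.2 hv)]

theorem gapProd_mul_gapProd_le {m : ℕ} {β : ℝ} (hβ : 0 < β) (y z : Fin m → ℝ) :
    gapProd β y * gapProd β z ≤ gapProd β (y ⊔ z) * gapProd β (y ⊓ z) := by
  simp only [gapProd, ← Finset.prod_mul_distrib]
  refine Finset.prod_le_prod
    (fun _ _ => mul_nonneg (posPow_nonneg _ _) (posPow_nonneg _ _)) fun p _ => ?_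
  simp only [Pi.sup_apply, Pi.inf_apply]
  rcases le_total (y p.2) (z p.2) with h2 | h2 <;> rcases le_total (y p.1) (z p.1) with h1 | h1 <;>
    simp only [sup_of_le_left, sup_of_le_right, inf_of_le_left, inf_of_le_right, h1, h2]
  · rw [mul_comm]
  · exact posPow_mul_posPow_le hβ (by linarith) (by linarith) (by ring)
  · rw [mul_comm]
    exact posPow_mul_posPow_le hβ (by linarith) (by linarith) (by ring)
  · exact le_rfl

/-- A bounded regularization of `t ↦ t⁻¹` on the positive half-line. -/
noncomputable def regInv (δ t : ℝ) : ℝ := (δ + max t 0)⁻¹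

theorem regInv_pos {δ : ℝ} (hδ : 0 < δ) (t : ℝ) : 0 < regInv δ t :=
  inv_pos.2 (by have := le_max_right t 0; linarith)

theorem regInv_le {δ : ℝ} (hδ : 0 < δ) (t : ℝ) : regInv δ t ≤ δ⁻¹ :=
  inv_anti₀ hδ (by have := le_max_right t 0; linarith)

theorem continuous_regInv {δ : ℝ} (hδ : 0 < δ) : Continuous (regInv δ) := by
  refine (by fun_prop : Continuous fun t : ℝ => δ + max t 0).inv₀ fun t => ?_
  have := le_max_right t 0
  positivity

/-- The single-particle factor of the perturbed weight. -/
noncomputable def edgeFactor (β c s δ t y : ℝ) : ℝ :=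
  posPow β y * (1 + t * regInv δ y) ^ β * Real.exp (-c * (s - y) ^ 2)

theorem edgeFactor_of_pos {β c s δ t y : ℝ} (hy : 0 < y) (hδ : 0 < δ) (ht : 0 ≤ δ + y + t) :
    edgeFactor β c s δ t y = (y / (δ + y) * (δ + y + t)) ^ β * Real.exp (-c * (s - y) ^ 2) := by
  have hd : (0 : ℝ) < δ + y := by linarith
  have : 1 + t * regInv δ y = (δ + y + t) / (δ + y) := by
    rw [regInv, max_eq_left hy.le]; field_simp
  rw [edgeFactor, this, posPow_of_pos hy, ← Real.mul_rpow hy.le (by positivity)]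
  congr 2
  ring

theorem edgeFactor_of_nonpos {β c s δ t y : ℝ} (hβ : 0 < β) (hy : y ≤ 0) :
    edgeFactor β c s δ t y = 0 := by
  rw [edgeFactor, posPow_of_nonpos hβ hy, zero_mul, zero_mul]

theorem edgeFactor_nonneg {β c s δ t : ℝ} (hδ : 0 < δ) (ht : |t| ≤ δ) (y : ℝ) :
    0 ≤ edgeFactor β c s δ t y := by
  have h1 : |t * regInv δ y| ≤ 1 := by
    rw [abs_mul, abs_of_pos (regInv_pos hδ y)]
    calc |t| * regInv δ y ≤ δ * δ⁻¹ := by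
          gcongr
          · exact (regInv_pos hδ y).le
          · exact regInv_le hδ y
      _ = 1 := mul_inv_cancel₀ hδ.ne'
  have := (abs_le.1 h1).1
  exact mul_nonneg (mul_nonneg (posPow_nonneg _ _) (Real.rpow_nonneg (by linarith) _))
    (Real.exp_pos _).le

theorem edgeFactor_mul_edgeFactor_le {β c δ h : ℝ} (hβ : 0 < β) (hc : 0 < c) (hh : 0 < h)
    (hδ : h < δ) (s y z : ℝ) :
    edgeFactor β c s δ h y * edgeFactor β c s δ (-h) (z + h) ≤
      edgeFactor β c s δ 0 (y ⊔ z) * edgeFactor β c s δ 0 (y ⊓ z + h) := by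
  have hδ0 : 0 < δ := hh.trans hδ
  have h0 : |(0 : ℝ)| ≤ δ := by simpa using hδ0.le
  rcases le_or_gt y 0 with hy | hy
  · rw [edgeFactor_of_nonpos hβ hy, zero_mul]
    exact mul_nonneg (edgeFactor_nonneg hδ0 h0 _) (edgeFactor_nonneg hδ0 h0 _)
  rcases le_or_gt (z + h) 0 with hz | hz
  · rw [edgeFactor_of_nonpos hβ hz, mul_zero]
    exact mul_nonneg (edgeFactor_nonneg hδ0 h0 _) (edgeFactor_nonneg hδ0 h0 _)
  have p1 : 0 < δ + y := by linarith
  have p2 : 0 < δ + (z + h) := by linarith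
  have p3 : 0 < δ + z := by linarith
  have p4 : 0 < δ + (y + h) := by linarith
  rw [edgeFactor_of_pos hy hδ0 (by linarith), edgeFactor_of_pos hz hδ0 (by linarith)]
  rcases le_total y z with hyz | hyz
  · rw [sup_of_le_right hyz, inf_of_le_left hyz,
      edgeFactor_of_pos (by linarith : 0 < z) hδ0 (by linarith),
      edgeFactor_of_pos (by linarith : 0 < y + h) hδ0 (by linarith)]
    rw [mul_mul_mul_comm, mul_mul_mul_comm ((z / (δ + z) * (δ + z + 0)) ^ β), ← Real.mul_rpow,
      ← Real.mul_rpow, ← Real.exp_add, ← Real.exp_add]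
    rotate_left
    · have : 0 < δ + z + 0 := by linarith
      have : 0 < z := by linarith
      positivity
    · have : 0 < δ + (y + h) + 0 := by linarith
      positivity
    · positivity
    · have : 0 < δ + (z + h) + -h := by linarith
      positivity
    refine mul_le_mul (Real.rpow_le_rpow ?_ ?_ hβ.le) ?_ (Real.exp_pos _).le
      (Real.rpow_nonneg ?_ _)
    · have : 0 < δ + (z + h) + -h := by linarith
      positivity
    · have e1 : y / (δ + y) * (δ + y + h) * ((z + h) / (δ + (z + h)) * (δ + (z + h) + -h)) =
        (y * (z + h)) / ((δ + y) * (δ + (z + h))) * ((δ + z) * (δ + (y + h))) := by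
        field_simp; ring
      have e2 : z / (δ + z) * (δ + z + 0) * ((y + h) / (δ + (y + h)) * (δ + (y + h) + 0)) =
        z * (y + h) := by
        field_simp; ring
      rw [e1, e2, div_mul_eq_mul_div, div_le_iff₀ (by positivity)]
      have : 0 ≤ h * (z - y) := mul_nonneg hh.le (by linarith)
      have : 0 ≤ (h * (z - y)) * (δ ^ 2 + δ * (y + z + h)) :=
        mul_nonneg this (by nlinarith)
      nlinarith
    · rw [Real.exp_le_exp]
      have : 0 ≤ c * (h * (z - y)) := mul_nonneg hc.le (mul_nonneg hh.le (by linarith))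
      nlinarith
    · have : 0 < δ + z + 0 := by linarith
      have : 0 < z := by linarith
      positivity
  · rw [sup_of_le_left hyz, inf_of_le_right hyz,
      edgeFactor_of_pos hy hδ0 (by linarith),
      edgeFactor_of_pos hz hδ0 (by linarith)]
    rw [mul_mul_mul_comm, mul_mul_mul_comm ((y / (δ + y) * (δ + y + 0)) ^ β), ← Real.mul_rpow,
      ← Real.mul_rpow]
    rotate_left
    · positivity
    · positivity
    · positivity
    · have : 0 < δ + (z + h) + -h := by linarith
      positivity
    refine mul_le_mul_of_nonneg_right (Real.rpow_le_rpow ?_ ?_ hβ.le) (by positivity)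
    · have : 0 < δ + (z + h) + -h := by linarith
      positivity
    · rw [mul_mul_mul_comm (y / (δ + y)) (δ + y + h), mul_mul_mul_comm (y / (δ + y)) (δ + y + 0)]
      refine mul_le_mul_of_nonneg_left ?_ (by positivity)
      nlinarith

/-- The weight perturbed by shifting the regularized repulsion of the top particle. -/
noncomputable def pertWeight {m : ℕ} (β c s δ t : ℝ) (y : Fin m → ℝ) : ℝ :=
  edgeWeight β c s y * ∏ j, (1 + t * regInv δ (y j)) ^ β

theorem pertWeight_eq {m : ℕ} (β c s δ t : ℝ) (y : Fin m → ℝ) :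
    pertWeight β c s δ t y = gapProd β y * ∏ j, edgeFactor β c s δ t (y j) := by
  simp only [pertWeight, edgeWeight, edgeFactor, Finset.prod_mul_distrib, ← Real.exp_sum,
    Finset.mul_sum]
  ring

theorem pertWeight_zero {m : ℕ} (β c s δ : ℝ) (y : Fin m → ℝ) :
    pertWeight β c s δ 0 y = edgeWeight β c s y := by
  simp [pertWeight]

theorem one_add_mul_regInv_mem {δ t : ℝ} (hδ : 0 < δ) (ht : |t| ≤ δ) (y : ℝ) :
    0 ≤ 1 + t * regInv δ y ∧ 1 + t * regInv δ y ≤ 2 := by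
  have h1 : |t * regInv δ y| ≤ 1 := by
    rw [abs_mul, abs_of_pos (regInv_pos hδ y)]
    calc |t| * regInv δ y ≤ δ * δ⁻¹ := by
          gcongr
          · exact (regInv_pos hδ y).le
          · exact regInv_le hδ y
      _ = 1 := mul_inv_cancel₀ hδ.ne'
  have := abs_le.1 h1
  constructor <;> linarith

theorem pertWeight_nonneg {m : ℕ} {β c s δ t : ℝ} (hδ : 0 < δ) (ht : |t| ≤ δ) (y : Fin m → ℝ) :
    0 ≤ pertWeight β c s δ t y :=
  mul_nonneg (edgeWeight_nonneg _ _ _ _) (Finset.prod_nonneg fun _ _ =>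
    Real.rpow_nonneg (one_add_mul_regInv_mem hδ ht _).1 _)

theorem continuous_pertWeight {m : ℕ} {β δ : ℝ} (hβ : 0 < β) (hδ : 0 < δ) (c s t : ℝ) :
    Continuous (pertWeight β c s δ t : (Fin m → ℝ) → ℝ) :=
  (continuous_edgeWeight hβ.le c s).mul (continuous_finsetProd _ fun j _ =>
    (continuous_const.add (continuous_const.mul
      ((continuous_regInv hδ).comp (continuous_apply j)))).rpow_const fun _ => Or.inr hβ.le)

theorem integrable_pertWeight {m : ℕ} {β c δ t : ℝ} (hβ : 0 < β) (hc : 0 < c) (s : ℝ)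
    (hδ : 0 < δ) (ht : |t| ≤ δ) :
    Integrable (pertWeight β c s δ t : (Fin m → ℝ) → ℝ) := by
  refine ((integrable_edgeWeight hβ.le hc s).mul_const (∏ _j : Fin m, (2 : ℝ) ^ β)).mono'
    (continuous_pertWeight hβ hδ c s t).aestronglyMeasurable (Eventually.of_forall fun y => ?_)
  rw [Real.norm_eq_abs, abs_of_nonneg (pertWeight_nonneg hδ ht y)]
  refine mul_le_mul_of_nonneg_left (Finset.prod_le_prod (fun j _ =>
    Real.rpow_nonneg (one_add_mul_regInv_mem hδ ht _).1 _) fun j _ => ?_)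
    (edgeWeight_nonneg _ _ _ _)
  exact Real.rpow_le_rpow (one_add_mul_regInv_mem hδ ht _).1
    (one_add_mul_regInv_mem hδ ht _).2 hβ.le

theorem pertWeight_mul_pertWeight_le {m : ℕ} {β c δ h : ℝ} (hβ : 0 < β) (hc : 0 < c)
    (hh : 0 < h) (hδ : h < δ) (s : ℝ) (y z : Fin m → ℝ) :
    pertWeight β c s δ h y * pertWeight β c s δ (-h) (z + fun _ => h) ≤
      edgeWeight β c s (y ⊔ z) * edgeWeight β c s (y ⊓ z + fun _ => h) := by
  have hδ0 : 0 < δ := hh.trans hδ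
  have hgap : ∀ w : Fin m → ℝ, gapProd β (w + fun _ => h) = gapProd β w := fun w => by
    simp [gapProd]
  rw [← pertWeight_zero β c s δ, ← pertWeight_zero β c s δ, pertWeight_eq, pertWeight_eq,
    pertWeight_eq, pertWeight_eq, hgap, hgap, mul_mul_mul_comm,
    mul_mul_mul_comm (gapProd β (y ⊔ z)),
    ← Finset.prod_mul_distrib, ← Finset.prod_mul_distrib]
  have h1 : |h| ≤ δ := by rw [abs_of_pos hh]; exact hδ.le
  have h2 : |-h| ≤ δ := by rwa [abs_neg]
  refine mul_le_mul (gapProd_mul_gapProd_le hβ y z) (Finset.prod_le_prod (fun j _ =>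
    mul_nonneg (edgeFactor_nonneg hδ0 h1 _) (edgeFactor_nonneg hδ0 h2 _)) fun j _ => ?_)
    (Finset.prod_nonneg fun j _ =>
    mul_nonneg (edgeFactor_nonneg hδ0 h1 _) (edgeFactor_nonneg hδ0 h2 _))
    (mul_nonneg (gapProd_nonneg _ _) (gapProd_nonneg _ _))
  exact edgeFactor_mul_edgeFactor_le hβ hc hh hδ s (y j) (z j)

theorem integral_pertWeight_mul_le {m : ℕ} {β c δ h : ℝ} (hβ : 0 < β) (hc : 0 < c)
    (hh : 0 < h) (hδ : h < δ) (s : ℝ) :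
    (∫ y : Fin m → ℝ, pertWeight β c s δ h y) * (∫ y : Fin m → ℝ, pertWeight β c s δ (-h) y) ≤
      (∫ y : Fin m → ℝ, edgeWeight β c s y) ^ 2 := by
  have hδ0 : 0 < δ := hh.trans hδ
  have h1 : |h| ≤ δ := by rw [abs_of_pos hh]; exact hδ.le
  have h2 : |-h| ≤ δ := by rwa [abs_neg]
  have m1 : ∀ t, Measurable fun y : Fin m → ℝ => ENNReal.ofReal (pertWeight β c s δ t y) :=
    fun t => (continuous_pertWeight hβ hδ0 c s t).measurable.ennreal_ofReal
  have m0 : Measurable fun y : Fin m → ℝ => ENNReal.ofReal (edgeWeight β c s y) :=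
    (continuous_edgeWeight hβ.le c s).measurable.ennreal_ofReal
  have hs : Measurable fun y : Fin m → ℝ => y + fun _ => h := by fun_prop
  have := four_functions_lintegral (m1 h) ((m1 (-h)).comp hs) m0 (m0.comp hs) fun y z => by
    simp only [Function.comp_apply]
    rw [← ENNReal.ofReal_mul (pertWeight_nonneg hδ0 h1 _),
      ← ENNReal.ofReal_mul (edgeWeight_nonneg _ _ _ _)]
    exact ENNReal.ofReal_le_ofReal (pertWeight_mul_pertWeight_le hβ hc hh hδ s y z)
  simp only [Function.comp_apply] at this
  rw [lintegral_add_right_eq_self (fun y => ENNReal.ofReal (pertWeight β c s δ (-h) y)),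
    lintegral_add_right_eq_self (fun y => ENNReal.ofReal (edgeWeight β c s y)),
    ← ofReal_integral_eq_lintegral_ofReal (integrable_pertWeight hβ hc s hδ0 h1)
      (Eventually.of_forall (pertWeight_nonneg hδ0 h1)),
    ← ofReal_integral_eq_lintegral_ofReal (integrable_pertWeight hβ hc s hδ0 h2)
      (Eventually.of_forall (pertWeight_nonneg hδ0 h2)),
    ← ofReal_integral_eq_lintegral_ofReal (integrable_edgeWeight hβ.le hc s)
      (Eventually.of_forall (edgeWeight_nonneg _ _ _)),
    ← ENNReal.ofReal_mul (integral_nonneg (pertWeight_nonneg hδ0 h1)),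
    ← ENNReal.ofReal_mul (integral_nonneg (edgeWeight_nonneg _ _ _))] at this
  rw [sq]
  exact (ENNReal.ofReal_le_ofReal_iff (mul_nonneg (integral_nonneg (edgeWeight_nonneg _ _ _))
    (integral_nonneg (edgeWeight_nonneg _ _ _)))).1 this

theorem log_one_add_ge {x : ℝ} (hx : |x| ≤ 1 / 2) :
    x - x ^ 2 / 2 - 2 * |x| ^ 3 ≤ Real.log (1 + x) := by
  have h := Real.abs_log_sub_add_sum_range_le (x := -x) (by rw [abs_neg]; linarith) 2
  rw [abs_neg, sub_neg_eq_add] at h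
  have h2 : |x| ^ (2 + 1) / (1 - |x|) ≤ 2 * |x| ^ 3 := by
    rw [div_le_iff₀ (by linarith)]
    have h3 := mul_nonneg (pow_nonneg (abs_nonneg x) 3) (sub_nonneg.2 hx)
    norm_num only at h3 ⊢
    linarith
  have h3 := (abs_le.1 (h.trans h2)).1
  simp only [Finset.sum_range_succ, Finset.sum_range_zero] at h3
  norm_num at h3
  linarith

theorem exp_sub_ge {a r q : ℝ} (ha : |a| ≤ q) (hr : 0 ≤ r) (hrq : r ≤ 3 / 2 * q ^ 2)
    (hq : q ≤ 1 / 2) : 1 + a - r + a ^ 2 / 2 - 3 * q ^ 3 ≤ Real.exp (a - r) := by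
  have hq0 : 0 ≤ q := (abs_nonneg a).trans ha
  have hv : |a - r| ≤ 7 / 4 * q := by
    calc |a - r| ≤ |a| + |r| := abs_sub _ _
      _ ≤ q + 3 / 2 * q ^ 2 := by rw [abs_of_nonneg hr]; linarith
      _ ≤ 7 / 4 * q := by nlinarith
  have h := Real.exp_bound (x := a - r) (by linarith) (n := 3) (by norm_num)
  simp only [Finset.sum_range_succ, Finset.sum_range_zero, Nat.factorial] at h
  norm_num at h
  have h3 := (abs_le.1 h).1
  have h4 : |a - r| ^ 3 ≤ (7 / 4 * q) ^ 3 := pow_le_pow_left₀ (abs_nonneg _) hv 3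
  have h5 : a * r ≤ q * (3 / 2 * q ^ 2) :=
    mul_le_mul ((le_abs_self a).trans ha) hrq hr hq0
  nlinarith [pow_nonneg hq0 3, sq_nonneg r]

theorem prod_one_add_rpow_ge {m : ℕ} {β p : ℝ} (hβ : 1 ≤ β) {x : Fin m → ℝ}
    (hx : ∑ j, |x j| ≤ p) (hp : β * p ≤ 1 / 2) :
    1 + β * ∑ j, x j + (β ^ 2 * (∑ j, x j) ^ 2 - β * ∑ j, x j ^ 2) / 2 - 5 * (β * p) ^ 3 ≤
      ∏ j, (1 + x j) ^ β := by
  have hβ0 : 0 < β := by linarith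
  have hp0 : 0 ≤ p := (Finset.sum_nonneg fun j _ => abs_nonneg (x j)).trans hx
  have hp2 : p ≤ 1 / 2 := by nlinarith
  have hxj : ∀ j, |x j| ≤ p := fun j =>
    (Finset.single_le_sum (f := fun j => |x j|) (fun j _ => abs_nonneg (x j))
      (Finset.mem_univ j)).trans hx
  have hpos : ∀ j, 0 < 1 + x j := fun j => by
    have := (abs_le.1 ((hxj j).trans hp2)).1; linarith
  have e : ∏ j, (1 + x j) ^ β = Real.exp (β * ∑ j, Real.log (1 + x j)) := by
    rw [Finset.mul_sum, Real.exp_sum]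
    refine Finset.prod_congr rfl fun j _ => ?_
    rw [Real.rpow_def_of_pos (hpos j), mul_comm]
  have h2 : ∑ j, x j ^ 2 ≤ p ^ 2 := by
    calc ∑ j, x j ^ 2 ≤ ∑ j, |x j| * p := Finset.sum_le_sum fun j _ => by
          rw [← sq_abs, sq]; exact mul_le_mul_of_nonneg_left (hxj j) (abs_nonneg _)
      _ ≤ p ^ 2 := by rw [← Finset.sum_mul, sq]; exact mul_le_mul_of_nonneg_right hx hp0
  have h3 : ∑ j, |x j| ^ 3 ≤ p ^ 3 := by
    calc ∑ j, |x j| ^ 3 ≤ ∑ j, |x j| * p ^ 2 := Finset.sum_le_sum fun j _ => by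
          rw [pow_succ']
          exact mul_le_mul_of_nonneg_left (pow_le_pow_left₀ (abs_nonneg _) (hxj j) 2)
            (abs_nonneg _)
      _ ≤ p ^ 3 := by
          rw [← Finset.sum_mul, pow_succ' p 2]; exact mul_le_mul_of_nonneg_right hx (sq_nonneg p)
  have h3' : 0 ≤ ∑ j, |x j| ^ 3 := Finset.sum_nonneg fun j _ => pow_nonneg (abs_nonneg _) 3
  have h2' : 0 ≤ ∑ j, x j ^ 2 := Finset.sum_nonneg fun j _ => sq_nonneg _
  have hL : ∑ j, x j - (∑ j, x j ^ 2) / 2 - 2 * ∑ j, |x j| ^ 3 ≤ ∑ j, Real.log (1 + x j) := by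
    rw [Finset.sum_div, Finset.mul_sum, ← Finset.sum_sub_distrib, ← Finset.sum_sub_distrib]
    exact Finset.sum_le_sum fun j _ => log_one_add_ge ((hxj j).trans hp2)
  have hq0 : 0 ≤ β * p := by positivity
  have hb2 : β * p ^ 2 ≤ (β * p) ^ 2 := by nlinarith [mul_nonneg hβ0.le (sq_nonneg p)]
  have hb3 : β * p ^ 3 ≤ (β * p) ^ 3 := by
    rw [mul_pow]
    exact mul_le_mul_of_nonneg_right (le_self_pow₀ hβ (by norm_num)) (pow_nonneg hp0 3)
  have hb4 : (β * p) ^ 3 ≤ 1 / 2 * (β * p) ^ 2 := by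
    rw [pow_succ' _ 2]; exact mul_le_mul_of_nonneg_right hp (sq_nonneg _)
  have h2b := mul_le_mul_of_nonneg_left h2 hβ0.le
  have h3b := mul_le_mul_of_nonneg_left h3 hβ0.le
  have hmain := exp_sub_ge (a := β * ∑ j, x j)
    (r := β * (∑ j, x j ^ 2) / 2 + 2 * (β * ∑ j, |x j| ^ 3)) (q := β * p)
    (by
      rw [abs_mul, abs_of_pos hβ0]
      exact mul_le_mul_of_nonneg_left ((Finset.abs_sum_le_sum_abs _ _).trans hx) hβ0.le)
    (by positivity) (by linarith) hp
  rw [e]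
  refine le_trans ?_ (hmain.trans (Real.exp_le_exp.2 ?_))
  · rw [mul_pow β]
    linarith
  · have := mul_le_mul_of_nonneg_left hL hβ0.le
    linarith

theorem integral_edgeWeight_pos {m : ℕ} {β c : ℝ} (hβ : 0 < β) (hc : 0 < c) (s : ℝ) :
    0 < ∫ y : Fin m → ℝ, edgeWeight β c s y := by
  rw [integral_pos_iff_support_of_nonneg (fun y => edgeWeight_nonneg _ _ _ y)
    (integrable_edgeWeight hβ.le hc s)]
  refine (continuous_edgeWeight hβ.le c s).isOpen_support.measure_pos _
    ⟨fun j => (j : ℝ) + 1, ?_⟩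
  rw [Function.mem_support, edgeWeight_eq_exp]
  · exact (Real.exp_pos _).ne'
  · intro p hp
    have : (p.1 : ℕ) < p.2 := hp
    have : ((p.1 : ℕ) : ℝ) < (p.2 : ℕ) := by exact_mod_cast this
    linarith
  · intro j; positivity

theorem continuous_sum_regInv {m : ℕ} {δ : ℝ} (hδ : 0 < δ) :
    Continuous fun y : Fin m → ℝ => ∑ j, regInv δ (y j) :=
  continuous_finsetSum _ fun j _ => (continuous_regInv hδ).comp (continuous_apply j)

theorem continuous_sum_regInv_sq {m : ℕ} {δ : ℝ} (hδ : 0 < δ) :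
    Continuous fun y : Fin m → ℝ => ∑ j, regInv δ (y j) ^ 2 :=
  continuous_finsetSum _ fun j _ => ((continuous_regInv hδ).comp (continuous_apply j)).pow 2

theorem sum_regInv_nonneg {m : ℕ} {δ : ℝ} (hδ : 0 < δ) (y : Fin m → ℝ) :
    0 ≤ ∑ j, regInv δ (y j) := Finset.sum_nonneg fun _ _ => (regInv_pos hδ _).le

theorem sum_regInv_le {m : ℕ} {δ : ℝ} (hδ : 0 < δ) (y : Fin m → ℝ) :
    ∑ j, regInv δ (y j) ≤ m * δ⁻¹ :=
  (Finset.sum_le_sum fun j _ => regInv_le hδ (y j)).trans (by simp)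

theorem sum_regInv_sq_le {m : ℕ} {δ : ℝ} (hδ : 0 < δ) (y : Fin m → ℝ) :
    ∑ j, regInv δ (y j) ^ 2 ≤ m * δ⁻¹ ^ 2 :=
  (Finset.sum_le_sum fun j _ => pow_le_pow_left₀ (regInv_pos hδ _).le
    (regInv_le hδ (y j)) 2).trans (by simp)

theorem integrable_edgeWeight_mul_sum_regInv {m : ℕ} {β c δ : ℝ} (hβ : 0 ≤ β) (hc : 0 < c)
    (hδ : 0 < δ) (s : ℝ) :
    Integrable fun y : Fin m → ℝ => edgeWeight β c s y * ∑ j, regInv δ (y j) :=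
  (integrable_edgeWeight hβ hc s).mul_bdd (c := m * δ⁻¹)
    (continuous_sum_regInv hδ).aestronglyMeasurable (Eventually.of_forall fun y => by
      rw [Real.norm_eq_abs, abs_of_nonneg (sum_regInv_nonneg hδ y)]; exact sum_regInv_le hδ y)

theorem integrable_edgeWeight_mul_sum_regInv_pow {m : ℕ} {β c δ : ℝ} (hβ : 0 ≤ β) (hc : 0 < c)
    (hδ : 0 < δ) (s : ℝ) :
    Integrable fun y : Fin m → ℝ => edgeWeight β c s y * (∑ j, regInv δ (y j)) ^ 2 :=
  (integrable_edgeWeight hβ hc s).mul_bdd (c := (m * δ⁻¹) ^ 2)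
    ((continuous_sum_regInv hδ).pow 2).aestronglyMeasurable (Eventually.of_forall fun y => by
      rw [Real.norm_eq_abs, abs_of_nonneg (sq_nonneg _)]
      exact pow_le_pow_left₀ (sum_regInv_nonneg hδ y) (sum_regInv_le hδ y) 2)

theorem integrable_edgeWeight_mul_sum_regInv_sq {m : ℕ} {β c δ : ℝ} (hβ : 0 ≤ β) (hc : 0 < c)
    (hδ : 0 < δ) (s : ℝ) :
    Integrable fun y : Fin m → ℝ => edgeWeight β c s y * ∑ j, regInv δ (y j) ^ 2 :=
  (integrable_edgeWeight hβ hc s).mul_bdd (c := m * δ⁻¹ ^ 2)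
    (continuous_sum_regInv_sq hδ).aestronglyMeasurable (Eventually.of_forall fun y => by
      rw [Real.norm_eq_abs, abs_of_nonneg (Finset.sum_nonneg fun _ _ => sq_nonneg _)]
      exact sum_regInv_sq_le hδ y)

theorem integral_linear_combination {α : Type*} [MeasurableSpace α] {μ : Measure α}
    {f₀ f₁ f₂ f₃ : α → ℝ} (a₀ a₁ a₂ a₃ : ℝ) (h₀ : Integrable f₀ μ) (h₁ : Integrable f₁ μ)
    (h₂ : Integrable f₂ μ) (h₃ : Integrable f₃ μ) :
    Integrable (fun x => a₀ * f₀ x + a₁ * f₁ x + (a₂ * f₂ x + a₃ * f₃ x)) μ ∧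
    ∫ x, (a₀ * f₀ x + a₁ * f₁ x + (a₂ * f₂ x + a₃ * f₃ x)) ∂μ =
      a₀ * ∫ x, f₀ x ∂μ + a₁ * ∫ x, f₁ x ∂μ + (a₂ * ∫ x, f₂ x ∂μ + a₃ * ∫ x, f₃ x ∂μ) := by
  have k₀ := h₀.const_mul a₀
  have k₁ := h₁.const_mul a₁
  have k₂ := h₂.const_mul a₂
  have k₃ := h₃.const_mul a₃
  have k₄ : Integrable (fun x => a₀ * f₀ x + a₁ * f₁ x) μ := k₀.add k₁
  have k₅ : Integrable (fun x => a₂ * f₂ x + a₃ * f₃ x) μ := k₂.add k₃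
  refine ⟨k₄.add k₅, ?_⟩
  rw [integral_add k₄ k₅, integral_add k₀ k₁, integral_add k₂ k₃]
  simp only [integral_const_mul]

theorem integral_pertWeight_ge {m : ℕ} {β c δ t : ℝ} (hβ : 1 ≤ β) (hc : 0 < c) (hδ : 0 < δ)
    (s : ℝ) (ht : |t| ≤ δ) (hp : β * (|t| * (m * δ⁻¹)) ≤ 1 / 2) :
    (∫ y : Fin m → ℝ, edgeWeight β c s y) +
      t * (β * ∫ y : Fin m → ℝ, edgeWeight β c s y * ∑ j, regInv δ (y j)) +
      (t ^ 2 / 2 * (β ^ 2 * (∫ y : Fin m → ℝ, edgeWeight β c s y * (∑ j, regInv δ (y j)) ^ 2) -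
        β * ∫ y : Fin m → ℝ, edgeWeight β c s y * ∑ j, regInv δ (y j) ^ 2) -
      5 * (β * (|t| * (m * δ⁻¹))) ^ 3 * ∫ y : Fin m → ℝ, edgeWeight β c s y) ≤
      ∫ y : Fin m → ℝ, pertWeight β c s δ t y := by
  have hβ0 : 0 < β := by linarith
  have i0 := integrable_edgeWeight (m := m) hβ0.le hc s
  have i1 := integrable_edgeWeight_mul_sum_regInv (m := m) hβ0.le hc hδ s
  have i2 := integrable_edgeWeight_mul_sum_regInv_pow (m := m) hβ0.le hc hδ s
  have i3 := integrable_edgeWeight_mul_sum_regInv_sq (m := m) hβ0.le hc hδ s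
  obtain ⟨hi, he⟩ := integral_linear_combination (1 - 5 * (β * (|t| * (m * δ⁻¹))) ^ 3) (t * β)
    (t ^ 2 / 2 * β ^ 2) (-(t ^ 2 / 2 * β)) i0 i1 i2 i3
  refine le_trans (le_of_eq ?_) (integral_mono hi (integrable_pertWeight hβ0 hc s hδ ht)
    fun y => ?_)
  · rw [he]; ring
  · have hx : ∑ j, |t * regInv δ (y j)| ≤ |t| * (m * δ⁻¹) := by
      simp only [abs_mul, ← Finset.mul_sum, abs_of_pos (regInv_pos hδ _)]
      exact mul_le_mul_of_nonneg_left (sum_regInv_le hδ y) (abs_nonneg t)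
    have h := mul_le_mul_of_nonneg_left (prod_one_add_rpow_ge hβ hx hp)
      (edgeWeight_nonneg β c s y)
    simp only [mul_pow t, ← Finset.mul_sum] at h
    simp only [pertWeight]
    refine le_trans (le_of_eq ?_) h
    ring

/-- A reverse Cauchy-Schwarz (variance) inequality for `∑ j, regInv δ (y j)`. -/
theorem variance_sum_regInv_le {m : ℕ} {β c δ : ℝ} (hβ : 1 ≤ β) (hc : 0 < c) (hδ : 0 < δ)
    (s : ℝ) :
    (∫ y : Fin m → ℝ, edgeWeight β c s y) *
      (β * (∫ y : Fin m → ℝ, edgeWeight β c s y * (∑ j, regInv δ (y j)) ^ 2) -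
        ∫ y : Fin m → ℝ, edgeWeight β c s y * ∑ j, regInv δ (y j) ^ 2) ≤
      β * (∫ y : Fin m → ℝ, edgeWeight β c s y * ∑ j, regInv δ (y j)) ^ 2 := by
  have hβ0 : 0 < β := by linarith
  have key := fun t => integral_pertWeight_ge (m := m) (t := t) hβ hc hδ s
  have hT := fun h => integral_pertWeight_mul_le (m := m) (δ := δ) (h := h) hβ0 hc
  have hF := integral_edgeWeight_pos (m := m) hβ0 hc s
  set F := ∫ y : Fin m → ℝ, edgeWeight β c s y
  set A := ∫ y : Fin m → ℝ, edgeWeight β c s y * ∑ j, regInv δ (y j)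
  set D := β ^ 2 * (∫ y : Fin m → ℝ, edgeWeight β c s y * (∑ j, regInv δ (y j)) ^ 2) -
        β * ∫ y : Fin m → ℝ, edgeWeight β c s y * ∑ j, regInv δ (y j) ^ 2 with hD
  set P : ℝ := m * δ⁻¹ with hP
  have hlim : Tendsto (fun h : ℝ => F * (D - 10 * (β * P) ^ 3 * F * h)) (𝓝[>] 0)
      (𝓝 (F * (D - 10 * (β * P) ^ 3 * F * 0))) :=
    ((by fun_prop : Continuous fun h : ℝ => F * (D - 10 * (β * P) ^ 3 * F * h)).tendsto 0).mono_left
      nhdsWithin_le_nhds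
  have hle : F * D ≤ β ^ 2 * A ^ 2 := by
    rw [mul_zero, sub_zero] at hlim
    refine le_of_tendsto hlim ?_
    have ev : ∀ f : ℝ → ℝ, Continuous f → 0 < f 0 → ∀ᶠ h in 𝓝[>] (0 : ℝ), 0 < f h :=
      fun f hf h0 => nhdsWithin_le_nhds (hf.continuousAt.eventually (lt_mem_nhds h0))
    have e1 := ev (fun h => δ - h) (by fun_prop) (by simpa)
    have e2 := ev (fun h => 1 / 2 - β * (h * P)) (by fun_prop) (by simp)
    have e3 := ev (fun h => F + h * (β * A) + (h ^ 2 / 2 * D - 5 * (β * (h * P)) ^ 3 * F))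
      (by fun_prop) (by simpa)
    have e4 := ev (fun h => F - h * (β * A) + (h ^ 2 / 2 * D - 5 * (β * (h * P)) ^ 3 * F))
      (by fun_prop) (by simpa)
    filter_upwards [e1, e2, e3, e4, self_mem_nhdsWithin] with h h1 h2 h3 h4 h0
    have h0 : 0 < h := h0
    have k1 := key h (by rw [abs_of_pos h0]; linarith) (by rw [abs_of_pos h0]; linarith)
    have k2 := key (-h) (by rw [abs_neg, abs_of_pos h0]; linarith)
      (by rw [abs_neg, abs_of_pos h0]; linarith)
    rw [abs_of_pos h0] at k1
    rw [abs_neg, abs_of_pos h0, neg_mul, ← sub_eq_add_neg, neg_sq] at k2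
    have k3 := (mul_le_mul k1 k2 h4.le (h3.le.trans k1)).trans (hT h h0 (by linarith) s)
    have k4 : F * (h ^ 2 * D - 10 * (β * (h * P)) ^ 3 * F) ≤ (h * (β * A)) ^ 2 := by
      nlinarith [sq_nonneg (h ^ 2 / 2 * D - 5 * (β * (h * P)) ^ 3 * F)]
    have hh : 0 < h ^ 2 := by positivity
    refine le_of_mul_le_mul_left ?_ hh
    calc _ = F * (h ^ 2 * D - 10 * (β * (h * P)) ^ 3 * F) := by ring
      _ ≤ _ := k4
      _ = _ := by ring
  refine le_of_mul_le_mul_left ?_ hβ0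
  calc _ = F * D := by rw [hD]; ring
    _ ≤ _ := hle
    _ = _ := by ring

theorem hasDerivAt_regInv {δ : ℝ} (hδ : 0 < δ) {t : ℝ} (ht : t ≠ 0) :
    HasDerivAt (regInv δ) (if 0 < t then -regInv δ t ^ 2 else 0) t := by
  rcases lt_or_gt_of_ne ht with h | h
  · rw [if_neg h.not_gt]
    refine (hasDerivAt_const t (δ⁻¹)).congr_of_eventuallyEq ?_
    filter_upwards [gt_mem_nhds h] with u hu
    rw [regInv, max_eq_right hu.le, add_zero]
  · rw [if_pos h]
    have h1 : HasDerivAt (fun u : ℝ => (δ + u)⁻¹) (-1 / (δ + t) ^ 2) t :=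
      ((hasDerivAt_id t).const_add δ).inv (by simp only [id]; linarith)
    refine (h1.congr_of_eventuallyEq ?_).congr_deriv ?_
    · filter_upwards [lt_mem_nhds h] with u hu
      rw [regInv, max_eq_left hu.le]
    · rw [regInv, max_eq_left h.le, inv_pow, neg_div, one_div]

theorem sum_regInv_mul_sum_inv {m : ℕ} {δ : ℝ} (hδ : 0 < δ) {y : Fin m → ℝ}
    (hy : ∀ j, 0 < y j) (hinj : Function.Injective y) :
    ∑ j, regInv δ (y j) * ∑ i, (y j - y i)⁻¹ =
      -((∑ j, regInv δ (y j)) ^ 2 - ∑ j, regInv δ (y j) ^ 2) / 2 := by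
  have h1 : ∑ j, regInv δ (y j) * ∑ i, (y j - y i)⁻¹ =
      ∑ j, ∑ i, regInv δ (y j) * (y j - y i)⁻¹ := by simp only [Finset.mul_sum]
  have h2 : ∑ j, regInv δ (y j) * ∑ i, (y j - y i)⁻¹ =
      ∑ j, ∑ i, regInv δ (y i) * (y i - y j)⁻¹ := by rw [h1, Finset.sum_comm]
  have h3 : ∀ j i, regInv δ (y j) * (y j - y i)⁻¹ + regInv δ (y i) * (y i - y j)⁻¹ =
      (if j = i then regInv δ (y j) ^ 2 else 0) - regInv δ (y j) * regInv δ (y i) := by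
    intro j i
    split_ifs with hji
    · subst hji; simp [sq]
    · have hne : y j - y i ≠ 0 := sub_ne_zero.2 (hinj.ne hji)
      have hne' : y i - y j ≠ 0 := sub_ne_zero.2 (hinj.ne (Ne.symm hji))
      have p1 : δ + y j ≠ 0 := by have := hy j; positivity
      have p2 : δ + y i ≠ 0 := by have := hy i; positivity
      rw [regInv, regInv, max_eq_left (hy j).le, max_eq_left (hy i).le,
        ← neg_sub (y j) (y i), inv_neg]
      field_simp
      ring
  have h4 : 2 * ∑ j, regInv δ (y j) * ∑ i, (y j - y i)⁻¹ =
      ∑ j, regInv δ (y j) ^ 2 - (∑ j, regInv δ (y j)) ^ 2 := by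
    rw [two_mul]
    nth_rewrite 1 [h1]
    rw [h2, ← Finset.sum_add_distrib]
    simp only [← Finset.sum_add_distrib, h3, Finset.sum_sub_distrib, Finset.sum_ite_eq,
      Finset.mem_univ, if_true, sq (∑ j, regInv δ (y j)), Finset.sum_mul_sum]
  linarith

theorem pos_and_injective_of_edgeWeight_ne_zero {m : ℕ} {β c s : ℝ} (hβ : 0 < β)
    {y : Fin m → ℝ} (h : edgeWeight β c s y ≠ 0) :
    (∀ j, 0 < y j) ∧ Function.Injective y := by
  refine ⟨fun j => ?_, fun i j hij => ?_⟩
  · by_contra hj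
    exact h (edgeWeight_eq_zero_of_nonpos hβ c s (not_lt.1 hj))
  · by_contra hne
    rcases lt_or_gt_of_ne hne with hlt | hlt
    · exact h (edgeWeight_eq_zero_of_gap hβ c s (p := (i, j)) hlt (by simp [hij]))
    · exact h (edgeWeight_eq_zero_of_gap hβ c s (p := (j, i)) hlt (by simp [hij]))

theorem loop_regInv_le {m : ℕ} {β c δ : ℝ} (hβ : 1 ≤ β) (hc : 0 < c) (hδ : 0 < δ) (s : ℝ) :
    (3 * β / 2 - 1) * ∫ y : Fin m → ℝ, edgeWeight β c s y * ∑ j, regInv δ (y j) ^ 2 ≤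
      β / 2 * (∫ y : Fin m → ℝ, edgeWeight β c s y * (∑ j, regInv δ (y j)) ^ 2) -
      2 * c * (s + δ) * (∫ y : Fin m → ℝ, edgeWeight β c s y * ∑ j, regInv δ (y j)) +
      2 * c * m * ∫ y : Fin m → ℝ, edgeWeight β c s y := by
  have hβ0 : 0 < β := by linarith
  have i0 := integrable_edgeWeight (m := m) hβ0.le hc s
  have i1 := integrable_edgeWeight_mul_sum_regInv (m := m) hβ0.le hc hδ s
  have i2 := integrable_edgeWeight_mul_sum_regInv_pow (m := m) hβ0.le hc hδ s
  have i3 := integrable_edgeWeight_mul_sum_regInv_sq (m := m) hβ0.le hc hδ s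
  have hle1 : δ⁻¹ ≤ δ⁻¹ + δ⁻¹ ^ 2 := by linarith [sq_nonneg δ⁻¹]
  have hle2 : δ⁻¹ ^ 2 ≤ δ⁻¹ + δ⁻¹ ^ 2 := by linarith [inv_pos.2 hδ]
  have loop := fun j : Fin m => integral_edgeWeight_mul_deriv_add hβ hc s
    (φ := regInv δ) (φ' := fun t => if 0 < t then -regInv δ t ^ 2 else 0) (M := δ⁻¹ + δ⁻¹ ^ 2)
    (continuous_regInv hδ)
    (fun t => by rw [abs_of_pos (regInv_pos hδ t)]; exact (regInv_le hδ t).trans hle1)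
    (Measurable.ite measurableSet_Ioi ((continuous_regInv hδ).measurable.pow_const 2).neg
      measurable_const)
    (fun t => by
      split_ifs
      · rw [abs_neg, abs_of_nonneg (sq_nonneg _)]
        exact (pow_le_pow_left₀ (regInv_pos hδ t).le (regInv_le hδ t) 2).trans hle2
      · rw [abs_zero]; positivity)
    (fun t ht => hasDerivAt_regInv hδ ht) j
  have hint : ∀ j : Fin m, Integrable fun y : Fin m → ℝ => edgeWeight β c s y *
      (if 0 < y j then -regInv δ (y j) ^ 2 else 0) +
      regInv δ (y j) * (edgeWeight β c s y * edgeScore β c s y j) :=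
    fun j => (loop j).1.add (loop j).2.1
  have hsum : ∫ y : Fin m → ℝ, ∑ j, (edgeWeight β c s y *
      (if 0 < y j then -regInv δ (y j) ^ 2 else 0) +
      regInv δ (y j) * (edgeWeight β c s y * edgeScore β c s y j)) = 0 := by
    rw [integral_finsetSum _ fun j _ => hint j]
    exact Finset.sum_eq_zero fun j _ => (loop j).2.2
  have hsumi : Integrable fun y : Fin m → ℝ => ∑ j, (edgeWeight β c s y *
      (if 0 < y j then -regInv δ (y j) ^ 2 else 0) +
      regInv δ (y j) * (edgeWeight β c s y * edgeScore β c s y j)) :=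
    integrable_finsetSum _ fun j _ => hint j
  obtain ⟨hi, he⟩ := integral_linear_combination (-(2 * c * m)) (2 * c * (s + δ))
    (-(β / 2)) (3 * β / 2 - 1) i0 i1 i2 i3
  have hmono := integral_mono hi hsumi fun y => by
    by_cases hw : edgeWeight β c s y = 0
    · simp [hw]
    obtain ⟨hy, hinj⟩ := pos_and_injective_of_edgeWeight_ne_zero hβ0 hw
    have hw0 := edgeWeight_nonneg β c s y
    simp only [if_pos (hy _)]
    have e1 : ∀ j, regInv δ (y j) * (s - y j) = (s + δ) * regInv δ (y j) - 1 := fun j => by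
      have := hy j
      have : δ + y j ≠ 0 := by positivity
      rw [regInv, max_eq_left (hy j).le]; field_simp; ring
    have e2 : ∀ j, regInv δ (y j) ^ 2 ≤ regInv δ (y j) * (y j)⁻¹ := fun j => by
      rw [sq]
      refine mul_le_mul_of_nonneg_left ?_ (regInv_pos hδ _).le
      rw [regInv, max_eq_left (hy j).le]
      exact inv_anti₀ (hy j) (by linarith)
    have e3 : ∑ j, regInv δ (y j) ^ 2 ≤ ∑ j, regInv δ (y j) * (y j)⁻¹ :=
      Finset.sum_le_sum fun j _ => e2 j
    have e4 : ∑ j, (edgeWeight β c s y * -regInv δ (y j) ^ 2 +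
        regInv δ (y j) * (edgeWeight β c s y * edgeScore β c s y j)) =
        edgeWeight β c s y * (-(∑ j, regInv δ (y j) ^ 2) +
          β * ∑ j, regInv δ (y j) * ∑ i, (y j - y i)⁻¹ +
          β * ∑ j, regInv δ (y j) * (y j)⁻¹ + 2 * c * ((s + δ) * ∑ j, regInv δ (y j) - m)) := by
      have e5 : (s + δ) * ∑ j, regInv δ (y j) - m = ∑ j, regInv δ (y j) * (s - y j) := by
        simp only [e1, Finset.sum_sub_distrib, Finset.mul_sum]; simp
      rw [e5, ← Finset.sum_neg_distrib, Finset.mul_sum Finset.univ _ β,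
        Finset.mul_sum Finset.univ _ β, Finset.mul_sum Finset.univ _ (2 * c),
        ← Finset.sum_add_distrib, ← Finset.sum_add_distrib, ← Finset.sum_add_distrib,
        Finset.mul_sum]
      refine Finset.sum_congr rfl fun j _ => ?_
      rw [edgeScore]; ring
    rw [e4, sum_regInv_mul_sum_inv hδ hy hinj]
    have e6 := mul_le_mul_of_nonneg_left (mul_le_mul_of_nonneg_left e3 hβ0.le) hw0
    linarith
  rw [he, hsum] at hmono
  linarith

theorem edge_quadratic_regInv_nonneg {m : ℕ} {β c δ : ℝ} (hβ : 1 ≤ β) (hc : 0 < c) (hδ : 0 < δ)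
    (s : ℝ) :
    0 ≤ β * (∫ y : Fin m → ℝ, edgeWeight β c s y * ∑ j, regInv δ (y j)) ^ 2 -
      4 * c * (s + δ) * (∫ y : Fin m → ℝ, edgeWeight β c s y * ∑ j, regInv δ (y j)) *
        (∫ y : Fin m → ℝ, edgeWeight β c s y) +
      4 * c * m * (∫ y : Fin m → ℝ, edgeWeight β c s y) ^ 2 := by
  have h1 := variance_sum_regInv_le (m := m) hβ hc hδ s
  have h2 := loop_regInv_le (m := m) hβ hc hδ s
  have h3 : 0 ≤ ∫ y : Fin m → ℝ, edgeWeight β c s y * ∑ j, regInv δ (y j) ^ 2 :=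
    integral_nonneg fun y => mul_nonneg (edgeWeight_nonneg _ _ _ _)
      (Finset.sum_nonneg fun _ _ => sq_nonneg _)
  have h4 := (integral_edgeWeight_pos (m := m) (by linarith : 0 < β) hc s).le
  have h5 := mul_le_mul_of_nonneg_left h2 h4
  have h6 : 0 ≤ (β - 1) * ((∫ y : Fin m → ℝ, edgeWeight β c s y) *
    ∫ y : Fin m → ℝ, edgeWeight β c s y * ∑ j, regInv δ (y j) ^ 2) :=
    mul_nonneg (by linarith) (mul_nonneg h4 h3)
  linarith

theorem integrable_edgeWeight_mul_sum_inv {m : ℕ} {β c : ℝ} (hβ : 1 ≤ β) (hc : 0 < c) (s : ℝ) :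
    Integrable fun y : Fin m → ℝ => edgeWeight β c s y * ∑ j, (y j)⁻¹ := by
  simp only [Finset.mul_sum]
  exact integrable_finsetSum _ fun j _ => integrable_edgeWeight_mul_inv hβ hc s j

/-- The quadratic inequality satisfied by the mean repulsion felt by the top particle. -/
theorem edge_quadratic_nonneg {m : ℕ} {β c : ℝ} (hβ : 1 ≤ β) (hc : 0 < c) (s : ℝ) :
    0 ≤ β * (∫ y : Fin m → ℝ, edgeWeight β c s y * ∑ j, (y j)⁻¹) ^ 2 -
      4 * c * s * (∫ y : Fin m → ℝ, edgeWeight β c s y * ∑ j, (y j)⁻¹) *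
        (∫ y : Fin m → ℝ, edgeWeight β c s y) +
      4 * c * m * (∫ y : Fin m → ℝ, edgeWeight β c s y) ^ 2 := by
  have hβ0 : 0 < β := by linarith
  have hδ0 : Tendsto (fun δ : ℝ => δ) (𝓝[>] 0) (𝓝 0) := nhdsWithin_le_nhds
  have hA : Tendsto (fun δ : ℝ => ∫ y : Fin m → ℝ, edgeWeight β c s y * ∑ j, regInv δ (y j))
      (𝓝[>] 0) (𝓝 (∫ y : Fin m → ℝ, edgeWeight β c s y * ∑ j, (y j)⁻¹)) := by
    refine tendsto_integral_filter_of_dominated_convergence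
      (fun y => edgeWeight β c s y * ∑ j, (y j)⁻¹) ?_ ?_
      (integrable_edgeWeight_mul_sum_inv hβ hc s) ?_
    · filter_upwards [self_mem_nhdsWithin] with δ hδ
      exact (integrable_edgeWeight_mul_sum_regInv hβ0.le hc hδ s).aestronglyMeasurable
    · filter_upwards [self_mem_nhdsWithin] with δ hδ
      have hδ : 0 < δ := hδ
      refine Eventually.of_forall fun y => ?_
      rw [Real.norm_eq_abs, abs_of_nonneg (mul_nonneg (edgeWeight_nonneg _ _ _ _)
        (sum_regInv_nonneg hδ y))]
      by_cases hw : edgeWeight β c s y = 0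
      · simp [hw]
      have hy := (pos_and_injective_of_edgeWeight_ne_zero hβ0 hw).1
      refine mul_le_mul_of_nonneg_left (Finset.sum_le_sum fun j _ => ?_)
        (edgeWeight_nonneg _ _ _ _)
      rw [regInv, max_eq_left (hy j).le]
      exact inv_anti₀ (hy j) (by linarith)
    · refine Eventually.of_forall fun y => ?_
      by_cases hw : edgeWeight β c s y = 0
      · simp [hw]
      have hy := (pos_and_injective_of_edgeWeight_ne_zero hβ0 hw).1
      refine (tendsto_finsetSum _ fun j _ => ?_).const_mul _
      simp only [regInv, max_eq_left (hy j).le]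
      simpa using (hδ0.add_const (y j)).inv₀ (by simpa using (hy j).ne')
  have hlim := (((hA.pow 2).const_mul β).sub ((((hδ0.const_add s).const_mul (4 * c)).mul
    hA).mul_const (∫ y : Fin m → ℝ, edgeWeight β c s y))).add_const
      (4 * c * m * (∫ y : Fin m → ℝ, edgeWeight β c s y) ^ 2)
  rw [add_zero] at hlim
  refine ge_of_tendsto hlim ?_
  filter_upwards [self_mem_nhdsWithin] with δ hδ
  exact edge_quadratic_regInv_nonneg hβ hc hδ s

theorem edgeWeight_eq_zero_center {m : ℕ} (β c s : ℝ) (y : Fin m → ℝ) :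
    edgeWeight β c s y = Real.exp (-c * m * s ^ 2) *
      (edgeWeight β c 0 y * Real.exp (2 * c * s * ∑ j, y j)) := by
  have : -c * ∑ j, (s - y j) ^ 2 =
      -c * m * s ^ 2 + (-c * ∑ j, (0 - y j) ^ 2 + 2 * c * s * ∑ j, y j) := by
    have h : ∀ j, (s - y j) ^ 2 = s ^ 2 + (0 - y j) ^ 2 - 2 * s * y j := fun j => by ring
    simp only [h, Finset.sum_add_distrib, Finset.sum_sub_distrib, ← Finset.mul_sum]
    simp
    ring
  rw [edgeWeight, this, Real.exp_add, Real.exp_add, edgeWeight]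
  ring

theorem hasDerivAt_integral_edgeWeight {m : ℕ} {β c : ℝ} (hβ : 0 ≤ β) (hc : 0 < c) (s : ℝ) :
    HasDerivAt (fun s => ∫ y : Fin m → ℝ, edgeWeight β c s y)
      (-(2 * c) * ∑ j, ∫ y : Fin m → ℝ, edgeWeight β c s y * (s - y j)) s := by
  set μ : Measure (Fin m → ℝ) :=
    volume.withDensity fun y => ENNReal.ofReal (edgeWeight β c 0 y) with hμ
  set X : (Fin m → ℝ) → ℝ := fun y => ∑ j, y j with hX
  have hm : Measurable fun y : Fin m → ℝ => ENNReal.ofReal (edgeWeight β c 0 y) :=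
    (continuous_edgeWeight hβ c 0).measurable.ennreal_ofReal
  have hint : ∀ g : (Fin m → ℝ) → ℝ, ∫ y, g y ∂μ = ∫ y, edgeWeight β c 0 y * g y := fun g => by
    rw [hμ, integral_withDensity_eq_integral_toReal_smul hm (by simp)]
    simp [ENNReal.toReal_ofReal (edgeWeight_nonneg _ _ _ _)]
  have hintegrable : ∀ t, Integrable (fun y => Real.exp (t * X y)) μ := fun t => by
    rw [hμ, integrable_withDensity_iff_integrable_smul' hm (by simp)]
    have h := (integrable_edgeWeight (m := m) hβ hc (t / (2 * c))).const_mul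
      (Real.exp (-c * m * (t / (2 * c)) ^ 2))⁻¹
    refine h.congr (Eventually.of_forall fun y => ?_)
    simp only [edgeWeight_eq_zero_center β c (t / (2 * c)), smul_eq_mul,
      ENNReal.toReal_ofReal (edgeWeight_nonneg _ _ _ _)]
    rw [inv_mul_cancel_left₀ (Real.exp_pos _).ne', mul_div_cancel₀ t (by positivity)]
  have hset : ProbabilityTheory.integrableExpSet X μ = Set.univ :=
    Set.eq_univ_of_forall hintegrable
  have hmgf := ProbabilityTheory.hasDerivAt_mgf (X := X) (μ := μ) (t := 2 * c * s)
    (by rw [hset, interior_univ]; trivial)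
  have h1 : ∀ s, ∫ y : Fin m → ℝ, edgeWeight β c s y =
      Real.exp (-c * m * s ^ 2) * ProbabilityTheory.mgf X μ (2 * c * s) := fun s => by
    rw [ProbabilityTheory.mgf, hint, ← integral_const_mul]
    exact integral_congr_ae (Eventually.of_forall fun y => edgeWeight_eq_zero_center β c s y)
  have hd1 : HasDerivAt (fun s : ℝ => Real.exp (-c * m * s ^ 2))
      (Real.exp (-c * m * s ^ 2) * (-c * m * (2 * s))) s := by
    simpa using ((hasDerivAt_pow 2 s).const_mul (-c * m)).exp
  have hd2 : HasDerivAt (fun s : ℝ => ProbabilityTheory.mgf X μ (2 * c * s))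
      ((∫ y, X y * Real.exp (2 * c * s * X y) ∂μ) * (2 * c)) s := by
    have h : HasDerivAt (fun s : ℝ => 2 * c * s) (2 * c) s := by
      simpa using (hasDerivAt_id s).const_mul (2 * c)
    exact HasDerivAt.comp s hmgf h
  simp only [h1]
  refine (hd1.mul hd2).congr_deriv ?_
  rw [← integral_finsetSum _ fun j _ => integrable_edgeWeight_mul_sub hβ hc s j]
  have h2 : ∀ y : Fin m → ℝ, ∑ j, edgeWeight β c s y * (s - y j) =
      m * s * edgeWeight β c s y - edgeWeight β c s y * X y := fun y => by
    rw [← Finset.mul_sum, Finset.sum_sub_distrib]; simp [hX]; ring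
  have i1 := (integrable_edgeWeight (m := m) hβ hc s).const_mul (m * s)
  have i2 : Integrable fun y : Fin m → ℝ => edgeWeight β c s y * X y := by
    have := i1.sub (integrable_finsetSum Finset.univ
      fun j _ => integrable_edgeWeight_mul_sub (m := m) hβ hc s j)
    refine this.congr (Eventually.of_forall fun y => ?_)
    simp only [Pi.sub_apply, h2]
    ring
  simp only [h2]
  rw [integral_sub i1 i2, integral_const_mul, h1 s, hint]
  have h3 : ∫ y : Fin m → ℝ, edgeWeight β c s y * X y = Real.exp (-c * m * s ^ 2) *
      ∫ y : Fin m → ℝ, edgeWeight β c 0 y * (X y * Real.exp (2 * c * s * X y)) := by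
    rw [← integral_const_mul]
    refine integral_congr_ae (Eventually.of_forall fun y => ?_)
    simp only
    rw [edgeWeight_eq_zero_center β c s]
    ring
  rw [h3]
  ring

theorem sum_integral_edgeWeight_mul_sub {m : ℕ} {β c : ℝ} (hβ : 1 ≤ β) (hc : 0 < c) (s : ℝ) :
    -(2 * c) * ∑ j, ∫ y : Fin m → ℝ, edgeWeight β c s y * (s - y j) =
      β * ∫ y : Fin m → ℝ, edgeWeight β c s y * ∑ j, (y j)⁻¹ := by
  have loop := fun j : Fin m => (integral_edgeWeight_mul_deriv_add hβ hc s
    (φ := fun _ => 1) (φ' := fun _ => 0) (M := 1) continuous_const (by simp) measurable_const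
    (by simp) (fun t _ => hasDerivAt_const t 1) j).2.2
  simp only [mul_zero, zero_add, one_mul] at loop
  have i1 := integrable_finsetSum Finset.univ
      fun j _ => integrable_edgeWeight_mul_sub (m := m) (by linarith : 0 ≤ β) hc s j
  have i2 := integrable_edgeWeight_mul_sum_inv (m := m) hβ hc s
  have hsum : ∫ y : Fin m → ℝ, ∑ j, edgeWeight β c s y * edgeScore β c s y j = 0 := by
    rw [integral_finsetSum _ fun j _ => integrable_edgeWeight_mul_edgeScore hβ hc s j]
    exact Finset.sum_eq_zero fun j _ => loop j
  have hz : ∀ y : Fin m → ℝ, ∑ j, ∑ i, (y j - y i)⁻¹ = 0 := fun y => by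
    have h1 : ∑ j, ∑ i, (y j - y i)⁻¹ = -∑ j, ∑ i, (y j - y i)⁻¹ := by
      conv_lhs => rw [Finset.sum_comm]
      simp only [← Finset.sum_neg_distrib]
      refine Finset.sum_congr rfl fun i _ => Finset.sum_congr rfl fun j _ => ?_
      rw [← inv_neg, neg_sub]
    linarith
  have he : ∀ y : Fin m → ℝ, ∑ j, edgeWeight β c s y * edgeScore β c s y j =
      β * (edgeWeight β c s y * ∑ j, (y j)⁻¹) +
        2 * c * ∑ j, edgeWeight β c s y * (s - y j) := fun y => by
    simp only [edgeScore, ← Finset.mul_sum, Finset.sum_add_distrib, hz]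
    ring
  simp only [he] at hsum
  rw [integral_add (i2.const_mul β) (i1.const_mul (2 * c)), integral_const_mul,
    integral_const_mul, integral_finsetSum _ fun j _ =>
      integrable_edgeWeight_mul_sub (by linarith) hc s j] at hsum
  linarith

theorem neg_of_hasDerivAt_log_of_lintegral_lt_top {f g d : ℝ → ℝ} {a : ℝ}
    (hfg : ∀ s, f s = Real.exp (g s)) (hd : ∀ s, HasDerivAt g (d s) s)
    (hne : ∀ s, a < s → d s ≠ 0) (hfin : ∫⁻ s in Set.Ioi a, ENNReal.ofReal (f s) ≠ ∞) :
    ∀ s, a < s → d s < 0 := by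
  rcases hasDerivWithinAt_forall_lt_or_forall_gt_of_forall_ne (convex_Ioi a)
    (fun s _ => (hd s).hasDerivWithinAt) (m := 0) hne with h | h
  · exact h
  · refine absurd ?_ hfin
    have hmono : MonotoneOn g (Set.Ioi a) := by
      refine monotoneOn_of_deriv_nonneg (convex_Ioi a)
        (fun s _ => (hd s).continuousAt.continuousWithinAt)
        (fun s _ => (hd s).differentiableAt.differentiableWithinAt) fun s hs => ?_
      rw [interior_Ioi] at hs
      rw [(hd s).deriv]
      exact (h s hs).le
    refine top_unique ?_
    calc ∞ = ∫⁻ _ in Set.Ioi (a + 1), ENNReal.ofReal (Real.exp (g (a + 1))) := by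
          rw [setLIntegral_const, Real.volume_Ioi, ENNReal.mul_top]
          simpa using Real.exp_pos _
      _ ≤ ∫⁻ s in Set.Ioi (a + 1), ENNReal.ofReal (f s) := by
          refine setLIntegral_mono' measurableSet_Ioi fun s hs => ENNReal.ofReal_le_ofReal ?_
          rw [hfg, Real.exp_le_exp]
          have hs : a + 1 < s := hs
          exact hmono (by simp) (show a < s by linarith) hs.le
      _ ≤ _ := lintegral_mono_set (Set.Ioi_subset_Ioi (by linarith))

theorem exp_shift_le_of_deriv_sq_ge {g d : ℝ → ℝ} {κ : ℝ} (hκ : 0 ≤ κ)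
    (hd : ∀ s, HasDerivAt g (d s) s) (hneg : ∀ s, 2 < s → d s < 0)
    (hsq : ∀ s, 2 < s → κ ^ 2 * (s ^ 2 - 4) ≤ d s ^ 2) {s ε : ℝ} (hs : 2 < s) (hε : 0 < ε) :
    g (s + ε) ≤ g s - κ * ε ^ ((3 : ℝ) / 2) / 2 := by
  have hbound : ∀ u v C : ℝ, u ≤ v → (∀ x, u < x → d x ≤ C) → g v - g u ≤ C * (v - u) :=
    fun u v C huv hC => by
    refine Convex.image_sub_le_mul_sub_of_deriv_le (convex_Icc u v)
      (fun x _ => (hd x).continuousAt.continuousWithinAt)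
      (fun x _ => (hd x).differentiableAt.differentiableWithinAt) (fun x hx => ?_) u
      (Set.left_mem_Icc.2 huv) v (Set.right_mem_Icc.2 huv) huv
    rw [interior_Icc] at hx
    rw [(hd x).deriv]
    exact hC x hx.1
  have h1 := hbound s (s + ε / 2) 0 (by linarith) fun x hx => (hneg x (by linarith)).le
  have h2 := hbound (s + ε / 2) (s + ε) (-(κ * √ε)) (by linarith) fun x hx => by
    have hx2 : 2 < x := by linarith
    have h3 : (κ * √ε) ^ 2 ≤ (-d x) ^ 2 := by
      rw [mul_pow, Real.sq_sqrt hε.le, neg_sq]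
      refine le_trans (mul_le_mul_of_nonneg_left ?_ (sq_nonneg κ)) (hsq x hx2)
      nlinarith
    have h4 := (sq_le_sq₀ (by positivity) (by linarith [hneg x hx2])).1 h3
    linarith
  have h5 : ε ^ ((3 : ℝ) / 2) = ε * √ε := by
    rw [Real.sqrt_eq_rpow, ← Real.rpow_one_add' hε.le (by norm_num)]
    norm_num
  rw [h5]
  linarith

/-- The unnormalized density of the position of the largest particle. -/
noncomputable def topDensity (m : ℕ) (β c s : ℝ) : ℝ :=
  Real.exp (-c * s ^ 2) * ∫ y : Fin m → ℝ, edgeWeight β c s y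

theorem topDensity_shift_le {m : ℕ} {β s ε : ℝ} (hβ : 1 ≤ β)
    (hfin : ∫⁻ s in Set.Ioi 2, ENNReal.ofReal (topDensity m β ((m + 1) * β / 4) s) ≠ ∞)
    (hs : 2 < s) (hε : 0 < ε) :
    topDensity m β ((m + 1) * β / 4) (s + ε) ≤
      Real.exp (-((m + 1) * β * ε ^ ((3 : ℝ) / 2) / 4)) * topDensity m β ((m + 1) * β / 4) s := by
  have hβ0 : 0 < β := by linarith
  have hn : (0 : ℝ) < m + 1 := by positivity
  set c : ℝ := (m + 1) * β / 4 with hcdef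
  have hc : 0 < c := by positivity
  have hF : ∀ s, 0 < ∫ y : Fin m → ℝ, edgeWeight β c s y := integral_edgeWeight_pos hβ0 hc
  set F : ℝ → ℝ := fun s => ∫ y : Fin m → ℝ, edgeWeight β c s y with hFdef
  set A : ℝ → ℝ := fun s => ∫ y : Fin m → ℝ, edgeWeight β c s y * ∑ j, (y j)⁻¹ with hAdef
  have hfg : ∀ s, topDensity m β c s = Real.exp (-c * s ^ 2 + Real.log (F s)) := fun s => by
    rw [Real.exp_add, Real.exp_log (hF s), topDensity]
  have hd : ∀ s, HasDerivAt (fun s => -c * s ^ 2 + Real.log (F s))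
      (-(2 * c * s) + β * A s / F s) s := fun s => by
    have h1 := hasDerivAt_integral_edgeWeight (m := m) hβ0.le hc s
    rw [sum_integral_edgeWeight_mul_sub hβ hc s] at h1
    refine (((hasDerivAt_pow 2 s).const_mul (-c)).add (h1.log (hF s).ne')).congr_deriv ?_
    simp only [Nat.cast_ofNat, Nat.add_one_sub_one, pow_one]
    ring
  have hsq : ∀ s, 2 < s →
      (2 * c) ^ 2 * (s ^ 2 - 4) ≤ (-(2 * c * s) + β * A s / F s) ^ 2 := fun s _ => by
    have hq : 0 ≤ β * A s ^ 2 - 4 * c * s * A s * F s + 4 * c * m * F s ^ 2 :=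
      edge_quadratic_nonneg (m := m) hβ hc s
    have hr : A s = A s / F s * F s := (div_mul_cancel₀ _ (hF s).ne').symm
    set r := A s / F s
    have hq' : 0 ≤ (β * r ^ 2 - 4 * c * s * r + 4 * c * m) * F s ^ 2 := by
      rw [hr] at hq
      refine hq.trans_eq ?_
      ring
    have hq2 := nonneg_of_mul_nonneg_left hq' (pow_pos (hF s) 2)
    have hq3 := mul_nonneg hβ0.le hq2
    have hcβ : 4 * c * m * β ≤ 4 * (2 * c) ^ 2 := by
      have : (m : ℝ) * β ≤ 4 * c := by rw [hcdef]; linarith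
      nlinarith
    rw [mul_div_assoc]
    nlinarith
  have hneg := neg_of_hasDerivAt_log_of_lintegral_lt_top hfg hd (fun s hs h0 => by
    have := hsq s hs
    rw [h0] at this
    have h2 : 0 < (2 * c) ^ 2 * (s ^ 2 - 4) := mul_pos (by positivity) (by nlinarith)
    linarith) hfin
  have hmain := exp_shift_le_of_deriv_sq_ge (by positivity : 0 ≤ 2 * c) hd hneg hsq hs hε
  rw [hfg, hfg, ← Real.exp_add, Real.exp_le_exp]
  refine hmain.trans_eq ?_
  rw [hcdef]
  ring

theorem prod_abs_sub_rpow_eq_det {n : ℕ} (β : ℝ) (x : Fin n → ℝ) :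
    ∏ p ∈ Finset.univ.filter (fun p : Fin n × Fin n => p.1 < p.2), |x p.1 - x p.2| ^ β =
      |(Matrix.vandermonde x).det| ^ β := by
  rw [Real.finsetProd_rpow _ _ (fun _ _ => abs_nonneg _), Matrix.det_vandermonde,
    Finset.prod_filter, Fintype.prod_prod_type, Finset.abs_prod]
  congr 1
  refine Finset.prod_congr rfl fun i _ => ?_
  rw [← Finset.prod_filter, Finset.filter_lt_eq_Ioi, Finset.abs_prod]
  exact Finset.prod_congr rfl fun j _ => abs_sub_comm _ _

theorem abs_det_vandermonde_comp_perm {n : ℕ} (x : Fin n → ℝ) (σ : Equiv.Perm (Fin n)) :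
    |(Matrix.vandermonde (x ∘ σ)).det| = |(Matrix.vandermonde x).det| := by
  have h : Matrix.vandermonde (x ∘ σ) = (Matrix.vandermonde x).submatrix σ id := rfl
  rw [h, Matrix.det_permute, abs_mul]
  rcases Int.units_eq_one_or (Equiv.Perm.sign σ) with h | h <;> simp [h]

/-- The part of the density supported on strictly decreasing configurations. -/
noncomputable def orderedDensity {n : ℕ} (β c : ℝ) (x : Fin n → ℝ) : ℝ :=
  gapProd β (-x) * Real.exp (-c * ∑ j, x j ^ 2)

theorem gapProd_neg_of_strictAnti {n : ℕ} (β : ℝ) {x : Fin n → ℝ} (hx : StrictAnti x) :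
    gapProd β (-x) = |(Matrix.vandermonde x).det| ^ β := by
  rw [← prod_abs_sub_rpow_eq_det, gapProd]
  refine Finset.prod_congr rfl fun p hp => ?_
  have h : 0 < x p.1 - x p.2 := sub_pos.2 (hx (by simpa using hp))
  have e : (-x) p.2 - (-x) p.1 = x p.1 - x p.2 := by simp only [Pi.neg_apply]; ring
  rw [e, posPow_of_pos h, abs_of_pos h]

theorem gapProd_neg_of_not_strictAnti {n : ℕ} {β : ℝ} (hβ : 0 < β) {x : Fin n → ℝ}
    (hx : ¬ StrictAnti x) : gapProd β (-x) = 0 := by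
  simp only [StrictAnti, not_forall, not_lt] at hx
  obtain ⟨i, j, hij, hle⟩ := hx
  refine Finset.prod_eq_zero (i := (i, j)) (by simpa using hij) (posPow_of_nonpos hβ ?_)
  simp only [Pi.neg_apply]
  linarith

theorem continuous_orderedDensity {n : ℕ} {β : ℝ} (hβ : 0 ≤ β) (c : ℝ) :
    Continuous (orderedDensity β c : (Fin n → ℝ) → ℝ) :=
  ((continuous_gapProd hβ).comp continuous_neg).mul (by fun_prop)

theorem orderedDensity_nonneg {n : ℕ} (β c : ℝ) (x : Fin n → ℝ) : 0 ≤ orderedDensity β c x :=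
  mul_nonneg (gapProd_nonneg _ _) (Real.exp_pos _).le

theorem gaussianDensity_eq_sum {n : ℕ} {β : ℝ} (hβ : 0 < β) (x : Fin n → ℝ) :
    gaussianDensity n β x =
      ∑ σ : Equiv.Perm (Fin n), orderedDensity β (n * β / 4) (x ∘ σ) := by
  have hexp : ∀ σ : Equiv.Perm (Fin n), Real.exp (-(n * β / 4) * ∑ j, (x ∘ σ) j ^ 2) =
      Real.exp (-((n : ℝ) * β / 2) * ∑ j, (x j) ^ 2 / 2) := fun σ => by
    rw [← Finset.sum_div, ← Equiv.sum_comp σ fun j => x j ^ 2]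
    simp only [Function.comp_apply]
    congr 1; ring
  simp only [gaussianDensity, orderedDensity, hexp, ← Finset.sum_mul]
  congr 1
  rw [prod_abs_sub_rpow_eq_det]
  by_cases hinj : Function.Injective x
  · set τ := Tuple.sort (-x)
    have hτ : StrictAnti (x ∘ τ) := by
      have h : Monotone (-x ∘ τ) := Tuple.monotone_sort (-x)
      have h' : Antitone (x ∘ τ) := fun i j hij => neg_le_neg_iff.1 (h hij)
      exact h'.strictAnti_of_injective (hinj.comp τ.injective)
    rw [Finset.sum_eq_single τ, gapProd_neg_of_strictAnti β hτ, abs_det_vandermonde_comp_perm]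
    · intro σ _ hne
      refine gapProd_neg_of_not_strictAnti hβ fun hσ => hne ?_
      have h : (-x) ∘ σ = (-x) ∘ τ := Tuple.unique_monotone
        (fun i j hij => neg_le_neg_iff.2 (hσ.antitone hij)) (Tuple.monotone_sort (-x))
      exact Equiv.ext fun i => hinj (neg_injective (congrFun h i))
    · simp
  · have hdet : (Matrix.vandermonde x).det = 0 := by
      by_contra h
      exact hinj (Matrix.det_vandermonde_ne_zero_iff.1 h)
    rw [hdet, abs_zero, Real.zero_rpow hβ.ne']
    refine (Finset.sum_eq_zero fun σ _ => gapProd_neg_of_not_strictAnti hβ fun hσ => hinj ?_).symm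
    have := hσ.injective.comp σ.symm.injective
    rwa [Function.comp_assoc, Equiv.self_comp_symm, Function.comp_id] at this

theorem lintegral_comp_perm {n : ℕ} (σ : Equiv.Perm (Fin n)) (f : (Fin n → ℝ) → ℝ≥0∞) :
    ∫⁻ x : Fin n → ℝ, f (x ∘ σ) = ∫⁻ x, f x := by
  have h := (volume_measurePreserving_piCongrLeft (fun _ : Fin n => ℝ) σ.symm).lintegral_comp_emb
    (MeasurableEquiv.measurableEmbedding _) f
  rw [← h]
  refine lintegral_congr fun x => congrArg f (funext fun i => ?_)
  have hi := MeasurableEquiv.piCongrLeft_apply_apply (β := fun _ => ℝ) σ.symm x (σ i)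
  rw [Equiv.symm_apply_apply] at hi
  exact hi.symm

theorem orderedDensity_cons_sub {m : ℕ} (β c t : ℝ) (y : Fin m → ℝ) :
    orderedDensity β c (Fin.cons t ((fun _ => t) - y) : Fin (m + 1) → ℝ) =
      Real.exp (-c * t ^ 2) * edgeWeight β c t y := by
  have hgap : gapProd β (-(Fin.cons t ((fun _ => t) - y) : Fin (m + 1) → ℝ)) =
      (∏ j, posPow β (y j)) * gapProd β y := by
    simp only [gapProd, Finset.prod_filter, Fintype.prod_prod_type, Fin.prod_univ_succ,
      Fin.succ_lt_succ_iff, Fin.succ_pos, Pi.neg_apply, Fin.cons_zero, Fin.cons_succ, Pi.sub_apply,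
      if_true, if_false, one_mul, Fin.not_lt_zero]
    congr 1
    · refine Finset.prod_congr rfl fun j _ => ?_
      congr 1; ring
    · refine Finset.prod_congr rfl fun i _ => Finset.prod_congr rfl fun j _ => ?_
      congr 2; ring
  rw [orderedDensity, hgap, edgeWeight, Fin.sum_univ_succ, mul_add, Real.exp_add]
  simp only [Fin.cons_zero, Fin.cons_succ, Pi.sub_apply]
  ring

theorem exists_lt_iff_of_orderedDensity_ne_zero {m : ℕ} {β c : ℝ} (hβ : 0 < β)
    {x : Fin (m + 1) → ℝ} (hx : orderedDensity β c x ≠ 0) (a : ℝ) :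
    (∃ j, a < x j) ↔ a < x 0 := by
  refine ⟨fun ⟨j, hj⟩ => hj.trans_le ?_, fun h => ⟨0, h⟩⟩
  by_contra hlt
  refine hx ?_
  rw [orderedDensity, gapProd_neg_of_not_strictAnti hβ fun h => hlt (h.antitone (Fin.zero_le j)),
    zero_mul]

theorem setLIntegral_gaussianDensity {m : ℕ} {β : ℝ} (hβ : 0 < β) (a : ℝ) :
    ∫⁻ x in {x : Fin (m + 1) → ℝ | ∃ j, a < x j}, ENNReal.ofReal (gaussianDensity (m + 1) β x) =
      (m + 1).factorial *
        ∫⁻ t in Set.Ioi a, ENNReal.ofReal (topDensity m β ((m + 1) * β / 4) t) := by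
  have hn : (0 : ℝ) < m + 1 := by positivity
  set c : ℝ := (m + 1) * β / 4 with hc
  have hc0 : 0 < c := by positivity
  set A : Set (Fin (m + 1) → ℝ) := {x | ∃ j, a < x j} with hA
  have hAm : MeasurableSet A := by
    have : A = ⋃ j, {x | a < x j} := by ext; simp [hA]
    rw [this]
    exact MeasurableSet.iUnion fun j => measurableSet_lt measurable_const (measurable_pi_apply j)
  set f : (Fin (m + 1) → ℝ) → ℝ≥0∞ :=
    A.indicator fun x => ENNReal.ofReal (orderedDensity β c x) with hf
  have hfm : Measurable f :=
    (continuous_orderedDensity hβ.le c).measurable.ennreal_ofReal.indicator hAm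
  have h1 : ∀ x, A.indicator (fun x => ENNReal.ofReal (gaussianDensity (m + 1) β x)) x =
      ∑ σ : Equiv.Perm (Fin (m + 1)), f (x ∘ σ) := fun x => by
    have hmem : ∀ σ : Equiv.Perm (Fin (m + 1)), x ∘ σ ∈ A ↔ x ∈ A := fun σ =>
      (σ.exists_congr_left (p := fun j => a < (x ∘ σ) j)).trans (by simp [hA])
    by_cases hx : x ∈ A
    · rw [Set.indicator_of_mem hx, gaussianDensity_eq_sum hβ,
        ENNReal.ofReal_sum_of_nonneg fun _ _ => orderedDensity_nonneg _ _ _]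
      refine Finset.sum_congr rfl fun σ _ => ?_
      rw [hf, Set.indicator_of_mem ((hmem σ).2 hx), hc]
      push_cast
      rfl
    · rw [Set.indicator_of_notMem hx]
      refine (Finset.sum_eq_zero fun σ _ => ?_).symm
      rw [hf, Set.indicator_of_notMem fun h => hx ((hmem σ).1 h)]
  rw [← lintegral_indicator hAm]
  simp only [h1]
  have hfσ : ∀ σ : Equiv.Perm (Fin (m + 1)), Measurable fun x : Fin (m + 1) → ℝ => f (x ∘ σ) :=
    fun σ => hfm.comp (measurable_pi_lambda _ fun i => measurable_pi_apply (σ i))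
  rw [lintegral_finsetSum _ fun σ _ => hfσ σ]
  simp only [lintegral_comp_perm, Finset.sum_const, Finset.card_univ, Fintype.card_perm,
    Fintype.card_fin, nsmul_eq_mul]
  congr 1
  rw [lintegral_fin_succ hfm, ← lintegral_indicator measurableSet_Ioi]
  refine lintegral_congr fun t => ?_
  rw [← lintegral_sub_left_eq_self _ (fun _ => t)]
  have h2 : ∀ y : Fin m → ℝ, f (Fin.cons t ((fun _ => t) - y) : Fin (m + 1) → ℝ) =
      (Set.Ioi a).indicator (fun _ => ENNReal.ofReal (Real.exp (-c * t ^ 2) *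
        edgeWeight β c t y)) t := fun y => by
    rw [← orderedDensity_cons_sub]
    by_cases h0 : orderedDensity β c (Fin.cons t ((fun _ => t) - y) : Fin (m + 1) → ℝ) = 0
    · simp [hf, Set.indicator, h0]
    · have := exists_lt_iff_of_orderedDensity_ne_zero hβ h0 a
      simp only [hf, Set.indicator, hA, Set.mem_ofPred_eq, Set.mem_Ioi, this, Fin.cons_zero]
  simp only [h2]
  by_cases ht : t ∈ Set.Ioi a
  · simp only [Set.indicator_of_mem ht]
    rw [topDensity, ← integral_const_mul, ofReal_integral_eq_lintegral_ofReal
      ((integrable_edgeWeight hβ.le hc0 t).const_mul _)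
      (Eventually.of_forall fun y => mul_nonneg (Real.exp_pos _).le (edgeWeight_nonneg _ _ _ _))]
  · simp only [Set.indicator_of_notMem ht, lintegral_zero]

theorem setLIntegral_topDensity_shift_le {m : ℕ} {β ε : ℝ} (hβ : 1 ≤ β) (hε : 0 < ε)
    (hfin : ∫⁻ s in Set.Ioi 2, ENNReal.ofReal (topDensity m β ((m + 1) * β / 4) s) ≠ ∞) :
    ∫⁻ s in Set.Ioi (2 + ε), ENNReal.ofReal (topDensity m β ((m + 1) * β / 4) s) ≤
      ENNReal.ofReal (Real.exp (-((m + 1) * β * ε ^ ((3 : ℝ) / 2) / 4))) *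
        ∫⁻ s in Set.Ioi 2, ENNReal.ofReal (topDensity m β ((m + 1) * β / 4) s) := by
  rw [← lintegral_indicator measurableSet_Ioi, ← lintegral_add_right_eq_self _ ε,
    ← lintegral_const_mul' _ _ ENNReal.ofReal_ne_top, ← lintegral_indicator measurableSet_Ioi]
  refine lintegral_mono fun s => ?_
  by_cases hs : 2 < s
  · rw [Set.indicator_of_mem (show s + ε ∈ Set.Ioi (2 + ε) by simpa using hs),
      Set.indicator_of_mem (show s ∈ Set.Ioi 2 from hs),
      ← ENNReal.ofReal_mul (Real.exp_pos _).le]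
    exact ENNReal.ofReal_le_ofReal (topDensity_shift_le hβ hfin hs hε)
  · rw [Set.indicator_of_notMem (by simpa using hs)]
    exact zero_le

theorem gaussianDensity_neg (n : ℕ) (β : ℝ) (x : Fin n → ℝ) :
    gaussianDensity n β (-x) = gaussianDensity n β x := by
  simp only [gaussianDensity, Pi.neg_apply, neg_sq, neg_sub_neg, abs_sub_comm]

theorem measurable_gaussianDensity (n : ℕ) (β : ℝ) : Measurable (gaussianDensity n β) := by
  unfold gaussianDensity
  fun_prop

/-- Ledoux-Rider localization theorem. -/
theorem ledoux_rider_localization :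
    ∃ C : ℝ, 0 < C ∧
      ∀ (n : ℕ), 1 ≤ n → ∀ β : ℝ, 1 ≤ β → ∀ ε : ℝ, 0 < ε → ε ≤ 1 →
        ∀ Z : ℝ, 0 < Z →
        ∀ μ : Measure (Fin n → ℝ),
          μ = volume.withDensity (fun x => ENNReal.ofReal (gaussianDensity n β x / Z)) →
          IsProbabilityMeasure μ →
          μ {x | ∃ j, 2 + ε < |x j|} ≤
            ENNReal.ofReal (C * Real.exp (-((n : ℝ) * β * ε ^ ((3 : ℝ) / 2)) / C)) := by
  refine ⟨4, by norm_num, fun n hn β hβ ε hε _ Z hZ μ hμ _ => ?_⟩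
  obtain ⟨m, rfl⟩ := Nat.exists_eq_add_of_le' hn
  have hβ0 : 0 < β := by linarith
  set I : ℝ → ℝ≥0∞ := fun a =>
    ∫⁻ t in Set.Ioi a, ENNReal.ofReal (topDensity m β ((m + 1) * β / 4) t) with hI
  set e : ℝ := Real.exp (-((m + 1) * β * ε ^ ((3 : ℝ) / 2) / 4)) with he
  have hmeas : ∀ a : ℝ, MeasurableSet {x : Fin (m + 1) → ℝ | ∃ j, a < x j} := fun a => by
    simp only [Set.ofPred_exists]
    exact MeasurableSet.iUnion fun j => measurableSet_lt measurable_const (measurable_pi_apply j)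
  have hμA : ∀ a, μ {x | ∃ j, a < x j} =
      ENNReal.ofReal Z⁻¹ * ((m + 1).factorial * I a) := fun a => by
    rw [hμ, withDensity_apply _ (hmeas a), ← setLIntegral_gaussianDensity hβ0,
      ← lintegral_const_mul' _ _ ENNReal.ofReal_ne_top]
    refine lintegral_congr fun x => ?_
    rw [← ENNReal.ofReal_mul (inv_pos.2 hZ).le, div_eq_inv_mul]
  have hfin : I 2 ≠ ∞ := fun h => by
    have h1 := measure_ne_top μ {x | ∃ j, 2 < x j}
    rw [hμA, h, ENNReal.mul_top (by simp [Nat.factorial_ne_zero]),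
      ENNReal.mul_top (by simpa using hZ)] at h1
    exact h1 rfl
  have hright : μ {x | ∃ j, 2 + ε < x j} ≤ ENNReal.ofReal e := by
    calc μ {x | ∃ j, 2 + ε < x j}
        ≤ ENNReal.ofReal Z⁻¹ * ((m + 1).factorial * (ENNReal.ofReal e * I 2)) := by
          rw [hμA]
          gcongr
          exact setLIntegral_topDensity_shift_le hβ hε hfin
      _ = ENNReal.ofReal e * μ {x | ∃ j, 2 < x j} := by rw [hμA]; ring
      _ ≤ ENNReal.ofReal e := mul_le_of_le_one_right zero_le prob_le_one
  have hneg : μ (Neg.neg ⁻¹' {x | ∃ j, 2 + ε < x j}) = μ {x | ∃ j, 2 + ε < x j} := by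
    rw [hμ, withDensity_apply _ (hmeas _), withDensity_apply _ (measurable_neg (hmeas _)),
      ← (Measure.measurePreserving_neg (volume : Measure (Fin (m + 1) → ℝ)))
        |>.setLIntegral_comp_preimage
        (hmeas _) ((measurable_gaussianDensity _ _).div_const Z).ennreal_ofReal]
    simp only [gaussianDensity_neg]
  have hsub : {x : Fin (m + 1) → ℝ | ∃ j, 2 + ε < |x j|} ⊆
      {x | ∃ j, 2 + ε < x j} ∪ Neg.neg ⁻¹' {x | ∃ j, 2 + ε < x j} := by
    rintro x ⟨j, hj⟩
    rcases lt_abs.1 hj with h | h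
    · exact Or.inl ⟨j, h⟩
    · exact Or.inr ⟨j, h⟩
  calc μ {x | ∃ j, 2 + ε < |x j|}
      ≤ μ {x | ∃ j, 2 + ε < x j} + μ (Neg.neg ⁻¹' {x | ∃ j, 2 + ε < x j}) :=
        (measure_mono hsub).trans (measure_union_le _ _)
    _ ≤ ENNReal.ofReal e + ENNReal.ofReal e := by rw [hneg]; gcongr
    _ = ENNReal.ofReal (e + e) := (ENNReal.ofReal_add (Real.exp_pos _).le (Real.exp_pos _).le).symm
    _ ≤ _ := by
      refine ENNReal.ofReal_le_ofReal ?_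
      push_cast
      rw [neg_div]
      linarith [Real.exp_pos (-((m + 1) * β * ε ^ ((3 : ℝ) / 2) / 4))]
end

section
/- Let β ≥ 1 be fixed, let β_n = β for all n, and let τ > 1. Then P-almost surely, liminf_{n→∞} n^{(β+2+τ)/β} · min_{j≠k} |x_j^{(n)} − x_k^{(n)}| > 0; that is, almost surely the non-normalized minimal spacing of the n-th coordinate configuration is bounded below by a positive constant times n^{−(β+2+τ)/β} for all sufficiently large n. -/
open MeasureTheory Filter Topology
open scoped ENNReal

/-- Non-normalized minimal spacing of a configuration. -/
noncomputable def minGap (n : ℕ) (x : Fin n → ℝ) : ℝ :=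
  sInf ((fun p : Fin n × Fin n => |x p.1 - x p.2|) '' {p | p.1 ≠ p.2})


section WeightedPolynomial

variable {ι : Type*}

theorem im_complex_sin (z : ℂ) : (Complex.sin z).im = Real.cos z.re * Real.sinh z.im := by
  rw [Complex.sin_eq, ← Complex.ofReal_sin, ← Complex.ofReal_cos, ← Complex.ofReal_sinh,
    ← Complex.ofReal_cosh, ← Complex.ofReal_mul, ← Complex.ofReal_mul, Complex.add_im,
    Complex.ofReal_im, zero_add, Complex.im_ofReal_mul, Complex.I_im, mul_one]

/-- The absolute value of a polynomial with roots `x k`, `k ∈ s`, times a Gaussian weight. -/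
noncomputable def weightedProd (s : Finset ι) (x : ι → ℝ) (n t : ℝ) : ℝ :=
  (∏ k ∈ s, |t - x k|) * Real.exp (-n * t ^ 2 / 4)

/-- The entire function whose modulus at real `w` is `weightedProd` at `2 a cos w`. -/
noncomputable def cosWeightedProd (s : Finset ι) (x : ι → ℝ) (n a : ℝ) (w : ℂ) : ℂ :=
  (∏ k ∈ s, (2 * a * Complex.cos w - x k)) * Complex.exp (-n * (2 * a * Complex.cos w) ^ 2 / 4)

theorem weightedProd_nonneg (s : Finset ι) (x : ι → ℝ) (n t : ℝ) : 0 ≤ weightedProd s x n t :=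
  mul_nonneg (Finset.prod_nonneg fun _ _ => abs_nonneg _) (Real.exp_pos _).le

theorem continuous_weightedProd (s : Finset ι) (x : ι → ℝ) (n : ℝ) :
    Continuous (weightedProd s x n) := by
  unfold weightedProd
  fun_prop

theorem differentiable_cosWeightedProd (s : Finset ι) (x : ι → ℝ) (n a : ℝ) :
    Differentiable ℂ (cosWeightedProd s x n a) := fun v =>
  DifferentiableAt.mul (DifferentiableAt.fun_finsetProd fun k _ => by fun_prop) (by fun_prop)

theorem norm_cosWeightedProd_of_eq (s : Finset ι) (x : ι → ℝ) (n a : ℝ) {w : ℂ} {t : ℝ}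
    (h : 2 * a * Complex.cos w = t) : ‖cosWeightedProd s x n a w‖ = weightedProd s x n t := by
  have h1 : Complex.exp (-n * (t : ℂ) ^ 2 / 4) = ((Real.exp (-n * t ^ 2 / 4) : ℝ) : ℂ) := by
    push_cast; rfl
  have h2 (k : ι) : ‖(t : ℂ) - x k‖ = |t - x k| := by
    rw [← Real.norm_eq_abs, ← Complex.norm_real]; push_cast; rfl
  rw [cosWeightedProd, h, h1, norm_mul, norm_prod, Complex.norm_real, Real.norm_eq_abs,
    Real.abs_exp, weightedProd]
  simp only [h2]

/-- A Bernstein-Walsh type inequality: a weighted polynomial of degree `#s` that is bounded by `M`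
on `[-2a, 2a]` is controlled on the whole complex plane, parametrized by `w ↦ 2 a cos w`. -/
theorem norm_cosWeightedProd_le {s : Finset ι} {x : ι → ℝ} {n a M : ℝ}
    (hM : ∀ t : ℝ, |t| ≤ 2 * a → weightedProd s x n t ≤ M)
    (ha : 0 ≤ a) {w : ℂ} (hw : 0 ≤ w.im) :
    ‖cosWeightedProd s x n a w‖
      ≤ M * Real.exp (s.card * w.im - n * a ^ 2 / 2 * (Complex.sin (2 * w)).im) := by
  let G : ℂ → ℂ := fun v => (∏ k ∈ s, (a * (v ^ 2 + 1) - x k * v)) *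
    Complex.exp (-n * a ^ 2 * (1 + v ^ 2) / 2)
  have hdiff : Differentiable ℂ G := fun v =>
    DifferentiableAt.mul (DifferentiableAt.fun_finsetProd fun k _ => by fun_prop) (by fun_prop)
  have key (u : ℂ) : G (Complex.exp (u * Complex.I)) =
      Complex.exp (s.card * (u * Complex.I)) * cosWeightedProd s x n a u *
      Complex.exp (-n * a ^ 2 / 2 * (Complex.I * Complex.sin (2 * u))) := by
    have hv : Complex.exp (u * Complex.I) = Complex.cos u + Complex.sin u * Complex.I :=
      Complex.exp_mul_I u
    have hsc := Complex.sin_sq_add_cos_sq u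
    have hI := Complex.I_sq
    have h1 (k : ι) : (a * (Complex.exp (u * Complex.I) ^ 2 + 1) - x k * Complex.exp (u * Complex.I))
        = Complex.exp (u * Complex.I) * (2 * a * Complex.cos u - x k) := by
      rw [hv]
      linear_combination (a * Complex.sin u ^ 2) * hI - a * hsc
    have h2 : Complex.exp (-n * a ^ 2 * (1 + Complex.exp (u * Complex.I) ^ 2) / 2) =
        Complex.exp (-n * (2 * a * Complex.cos u) ^ 2 / 4) *
          Complex.exp (-n * a ^ 2 / 2 * (Complex.I * Complex.sin (2 * u))) := by
      rw [← Complex.exp_add, hv, Complex.sin_two_mul]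
      congr 1
      linear_combination (-n * a ^ 2 * Complex.sin u ^ 2 / 2) * hI + (n * a ^ 2 / 2 : ℂ) * hsc
    simp only [G, cosWeightedProd, h1, Finset.prod_mul_distrib, Finset.prod_const]
    rw [← Complex.exp_nat_mul, h2]
    ring
  have hnorm (u : ℂ) : ‖G (Complex.exp (u * Complex.I))‖ =
      ‖cosWeightedProd s x n a u‖ *
        Real.exp (-(s.card * u.im - n * a ^ 2 / 2 * (Complex.sin (2 * u)).im)) := by
    have e1 : (s.card * (u * Complex.I) : ℂ).re = -(s.card * u.im) := by simp
    have e2 : (-n * a ^ 2 / 2 * (Complex.I * Complex.sin (2 * u)) : ℂ).re =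
        n * a ^ 2 / 2 * (Complex.sin (2 * u)).im := by
      have : (-n * a ^ 2 / 2 : ℂ) = ((-n * a ^ 2 / 2 : ℝ) : ℂ) := by push_cast; rfl
      rw [this, Complex.re_ofReal_mul, Complex.I_mul_re]; ring
    rw [key, norm_mul, norm_mul, Complex.norm_exp, Complex.norm_exp, e1, e2,
      mul_comm (Real.exp _), mul_assoc, ← Real.exp_add]
    congr 2; ring
  have hball : ∀ v : ℂ, ‖v‖ ≤ 1 → ‖G v‖ ≤ M := by
    intro v hv
    refine Complex.norm_le_of_forall_mem_frontier_norm_le (U := Metric.ball 0 1)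
      Metric.isBounded_ball hdiff.diffContOnCl ?_ ?_
    · intro z hz
      rw [frontier_ball _ one_ne_zero, mem_sphere_zero_iff_norm] at hz
      obtain ⟨θ, rfl⟩ := (Complex.norm_eq_one_iff z).1 hz
      have h0 : (Complex.sin (2 * θ)).im = 0 := by
        have : Complex.sin (2 * θ) = ((Real.sin (2 * θ) : ℝ) : ℂ) := by push_cast; rfl
        rw [this, Complex.ofReal_im]
      rw [hnorm, h0, norm_cosWeightedProd_of_eq s x n a (t := 2 * a * Real.cos θ)
        (by push_cast; rfl)]
      simp only [Complex.ofReal_im, mul_zero, sub_zero, neg_zero, Real.exp_zero, mul_one]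
      apply hM
      rw [abs_mul, abs_of_nonneg (by positivity : 0 ≤ 2 * a)]
      exact mul_le_of_le_one_right (by positivity) (Real.abs_cos_le_one θ)
    · rw [closure_ball _ one_ne_zero]; simpa using hv
  have h := hball (Complex.exp (w * Complex.I)) (by rw [Complex.norm_exp]; simpa using hw)
  rwa [hnorm, Real.exp_neg, ← div_eq_mul_inv, div_le_iff₀ (Real.exp_pos _)] at h

/-- Outside `[-5, 5]` a weighted polynomial is exponentially small. -/
theorem weightedProd_le_mul_exp_neg {s : Finset ι} {x : ι → ℝ} {n M : ℝ} (hs : s.card ≤ n)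
    (hM : ∀ t : ℝ, |t| ≤ 4 → weightedProd s x n t ≤ M) {t : ℝ} (ht : 5 ≤ |t|) :
    weightedProd s x n t ≤ M * Real.exp (-n) := by
  have hn : 0 ≤ n := (Nat.cast_nonneg _).trans hs
  have hM0 : 0 ≤ M := (weightedProd_nonneg s x n 0).trans (hM 0 (by norm_num))
  obtain ⟨y, hy, hc⟩ : ∃ y : ℝ, 1 / 3 ≤ y ∧ 4 * Real.cosh y = |t| := by
    have h1 : 1 ≤ |t| / 4 := by linarith
    refine ⟨Real.arcosh (|t| / 4), ?_, by rw [Real.cosh_arcosh h1]; ring⟩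
    by_contra! hlt
    have h0 : 0 ≤ Real.arcosh (|t| / 4) := Real.arcosh_nonneg h1
    have h2 := Real.cosh_le_exp_half_sq (Real.arcosh (|t| / 4))
    rw [Real.cosh_arcosh h1] at h2
    have h3 : Real.exp (Real.arcosh (|t| / 4) ^ 2 / 2) ≤ Real.exp (1 / 18) :=
      Real.exp_le_exp.2 (by nlinarith)
    have h4 := Real.abs_exp_sub_one_le (x := 1 / 18) (by norm_num [abs_le])
    rw [abs_le, abs_of_nonneg (by norm_num)] at h4
    linarith [h4.2]
  have bound (w : ℂ) (hw : w.im = y) (hsin : (Complex.sin (2 * w)).im = Real.sinh (2 * y))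
      (hcos : 2 * (2 : ℝ) * Complex.cos w = t) : weightedProd s x n t ≤ M * Real.exp (-n) := by
    rw [← norm_cosWeightedProd_of_eq s x n 2 hcos]
    refine (norm_cosWeightedProd_le (by norm_num; exact hM) zero_le_two
      (by rw [hw]; linarith)).trans ?_
    gcongr
    rw [hw, hsin]
    have := Real.self_le_sinh_iff.2 (by linarith : 0 ≤ 2 * y)
    nlinarith [mul_le_mul_of_nonneg_left this hn, mul_le_mul_of_nonneg_right hs (by linarith : 0 ≤ y),
      mul_le_mul_of_nonneg_left hy hn]
  have hcos : Complex.cos (y * Complex.I) = Real.cosh y := by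
    rw [Complex.cos_mul_I]; push_cast; rfl
  rcases abs_choice t with h | h
  · refine bound (y * Complex.I) (by simp) (by rw [im_complex_sin]; simp) ?_
    rw [hcos, ← h, ← hc]; push_cast; ring
  · refine bound (y * Complex.I + Real.pi) (by simp) ?_ ?_
    · rw [mul_add, Complex.sin_add_two_pi, im_complex_sin]; simp
    · have : t = -(4 * Real.cosh y) := by linarith
      rw [Complex.cos_add_pi, hcos, this]; push_cast; ring

theorem norm_deriv_cosWeightedProd_le {s : Finset ι} {x : ι → ℝ} {n a M : ℝ} (hs : s.card ≤ n)
    (hn : 1 ≤ n) (ha : 0 ≤ a) (hM : ∀ t : ℝ, |t| ≤ 2 * a → weightedProd s x n t ≤ M) (θ : ℝ) :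
    ‖deriv (cosWeightedProd s x n a) θ‖ ≤ M * Real.exp (1 + a ^ 2) * (2 * n) := by
  have hM0 : 0 ≤ M := (weightedProd_nonneg s x n 0).trans (hM 0 (by simpa using ha))
  have upper (w : ℂ) (h0 : 0 ≤ w.im) (h1 : w.im ≤ 1 / (2 * n)) :
      ‖cosWeightedProd s x n a w‖ ≤ M * Real.exp (1 + a ^ 2) := by
    refine (norm_cosWeightedProd_le hM ha h0).trans ?_
    gcongr
    have hy : w.im * (2 * n) ≤ 1 := (le_div_iff₀ (by linarith)).1 h1
    have hsin : -(2 * (2 * w.im)) ≤ (Complex.sin (2 * w)).im := by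
      have e : (Complex.sin (2 * w)).im = Real.cos (2 * w.re) * Real.sinh (2 * w.im) := by
        rw [im_complex_sin]; simp
      have hu : |2 * w.im| ≤ 1 := by
        rw [abs_of_nonneg (by linarith)]; nlinarith
      have h2 := (abs_le.1 (Real.abs_exp_sub_one_le hu)).2
      have h3 := (abs_le.1 (Real.abs_exp_sub_one_le (x := -(2 * w.im)) (by rwa [abs_neg]))).1
      rw [abs_of_nonneg (by linarith)] at h2
      rw [abs_neg, abs_of_nonneg (by linarith)] at h3
      have h4 : Real.sinh (2 * w.im) ≤ 2 * (2 * w.im) := by rw [Real.sinh_eq]; linarith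
      have h5 : 0 ≤ Real.sinh (2 * w.im) := Real.sinh_nonneg_iff.2 (by linarith)
      rw [e]
      nlinarith [Real.neg_one_le_cos (2 * w.re)]
    have h6 : s.card * w.im ≤ n * w.im := mul_le_mul_of_nonneg_right hs h0
    have h7 := mul_le_mul_of_nonneg_left hsin (by positivity : 0 ≤ n * a ^ 2 / 2)
    have h8 := mul_le_mul_of_nonneg_left hy (sq_nonneg a)
    nlinarith
  have h := Complex.norm_deriv_le_of_forall_mem_sphere_norm_le (c := (θ : ℂ)) (R := 1 / (2 * n))
    (C := M * Real.exp (1 + a ^ 2)) (by positivity)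
    (differentiable_cosWeightedProd s x n a).diffContOnCl ?_
  · rwa [div_div_eq_mul_div, div_one] at h
  · intro w hw
    have him : |w.im| ≤ 1 / (2 * n) := by
      rw [mem_sphere_iff_norm] at hw
      have := Complex.abs_im_le_norm (w - θ)
      rw [hw] at this
      simpa using this
    rcases le_total 0 w.im with h0 | h0
    · exact upper w h0 (by rwa [abs_of_nonneg h0] at him)
    · have := upper (-w) (by simpa using h0) (by rwa [abs_of_nonpos h0] at him)
      simpa [cosWeightedProd] using this

/-- A Bernstein inequality for Gaussian-weighted polynomials, in Lipschitz form. -/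
theorem abs_weightedProd_sub_le {s : Finset ι} {x : ι → ℝ} {n a M : ℝ} (hs : s.card ≤ n)
    (hn : 1 ≤ n) (ha : 1 ≤ a) (hM : ∀ t : ℝ, |t| ≤ 2 * a → weightedProd s x n t ≤ M)
    {t u : ℝ} (ht : |t| ≤ a) (hu : |u| ≤ a) :
    |weightedProd s x n t - weightedProd s x n u| ≤ 2 * Real.exp (1 + a ^ 2) * n * M * |t - u| := by
  have hM0 : 0 ≤ M := (weightedProd_nonneg s x n 0).trans (hM 0 (by simp; linarith))
  let g : ℝ → ℂ := fun r => cosWeightedProd s x n a (Real.arccos r)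
  have hmem {t : ℝ} (ht : |t| ≤ a) : t / (2 * a) ∈ Set.Icc (-(1 / 2) : ℝ) (1 / 2) := by
    rw [abs_le] at ht
    rw [Set.mem_Icc, le_div_iff₀ (by linarith), div_le_iff₀ (by linarith)]
    constructor <;> linarith [ht.1, ht.2]
  have hg {t : ℝ} (ht : |t| ≤ a) : ‖g (t / (2 * a))‖ = weightedProd s x n t := by
    refine norm_cosWeightedProd_of_eq s x n a ?_
    have := hmem ht
    rw [← Complex.ofReal_cos, Real.cos_arccos (by linarith [this.1]) (by linarith [this.2])]
    have : (a : ℂ) ≠ 0 := by exact_mod_cast (by linarith : a ≠ 0)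
    push_cast
    field_simp
  have hd : ∀ r ∈ Set.Icc (-(1 / 2) : ℝ) (1 / 2), HasDerivWithinAt g
      (deriv (cosWeightedProd s x n a) (Real.arccos r) * ((-(1 / √(1 - r ^ 2)) : ℝ) : ℂ))
      (Set.Icc (-(1 / 2) : ℝ) (1 / 2)) r := by
    intro r hr
    have h1 := (Real.hasDerivAt_arccos (x := r) (by linarith [hr.1]) (by linarith [hr.2])).ofReal_comp
    exact ((differentiable_cosWeightedProd s x n a _).hasDerivAt.comp r h1).hasDerivWithinAt
  have hb : ∀ r ∈ Set.Icc (-(1 / 2) : ℝ) (1 / 2),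
      ‖deriv (cosWeightedProd s x n a) (Real.arccos r) * ((-(1 / √(1 - r ^ 2)) : ℝ) : ℂ)‖ ≤
        M * Real.exp (1 + a ^ 2) * (2 * n) * 2 := by
    intro r hr
    rw [norm_mul]
    refine mul_le_mul (norm_deriv_cosWeightedProd_le hs hn (by linarith) hM _) ?_ (norm_nonneg _)
      (by positivity)
    rw [Complex.norm_real, norm_neg, Real.norm_of_nonneg (by positivity),
      div_le_iff₀ (Real.sqrt_pos.2 (by nlinarith [hr.1, hr.2]))]
    have : 1 / 2 ≤ √(1 - r ^ 2) := Real.le_sqrt_of_sq_le (by nlinarith [hr.1, hr.2])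
    linarith
  have h := (convex_Icc (-(1 / 2) : ℝ) (1 / 2)).norm_image_sub_le_of_norm_hasDerivWithin_le hd hb
    (hmem hu) (hmem ht)
  rw [← hg ht, ← hg hu]
  refine (abs_norm_sub_norm_le _ _).trans (h.trans ?_)
  rw [← sub_div, norm_div, Real.norm_eq_abs, Real.norm_of_nonneg (by linarith : 0 ≤ 2 * a),
    mul_div_assoc', div_le_iff₀ (by linarith)]
  have : 0 ≤ M * Real.exp (1 + a ^ 2) * n * |t - u| := by positivity
  nlinarith

/-- Near a root a weighted polynomial of degree at most `n` is smaller than its maximum by a factor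
of order `n` times the distance, while it is comparable to its maximum on an interval of length
of order `1 / n`. -/
theorem exists_forall_weightedProd_le_and_ge : ∃ L : ℝ, 1 ≤ L ∧
    ∀ {ι : Type} (s : Finset ι) (x : ι → ℝ) (n : ℝ), s.card ≤ n → 1 ≤ n →
    ∃ M t₀ : ℝ, 0 ≤ M ∧
      (∀ δ t : ℝ, δ ≤ 1 → Real.exp (-n) ≤ L * n * δ → (∃ k ∈ s, |x k - t| ≤ δ) →
        weightedProd s x n t ≤ L * n * δ * M) ∧
      (∀ t : ℝ, |t - t₀| ≤ 1 / (2 * (L * n)) → M / 2 ≤ weightedProd s x n t) := by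
  have hL : 1 ≤ 2 * Real.exp (1 + 6 ^ 2) := by
    linarith [Real.one_le_exp (by norm_num : (0 : ℝ) ≤ 1 + 6 ^ 2)]
  refine ⟨2 * Real.exp (1 + 6 ^ 2), hL, fun {ι} s x n hs hn => ?_⟩
  set L : ℝ := 2 * Real.exp (1 + 6 ^ 2)
  obtain ⟨t₀, -, hmax⟩ := isCompact_Icc.exists_isMaxOn (s := Set.Icc (-12 : ℝ) 12)
    ⟨0, by norm_num⟩ (continuous_weightedProd s x n).continuousOn
  have hM : ∀ t : ℝ, |t| ≤ 2 * 6 → weightedProd s x n t ≤ weightedProd s x n t₀ := fun t ht =>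
    hmax (by rw [abs_le] at ht; constructor <;> linarith [ht.1, ht.2])
  have hdecay {t : ℝ} (ht : 5 ≤ |t|) :=
    weightedProd_le_mul_exp_neg hs (fun t ht => hM t (by linarith)) ht
  have hlip {t u : ℝ} (ht : |t| ≤ 6) (hu : |u| ≤ 6) :=
    abs_weightedProd_sub_le hs hn (by norm_num) hM ht hu
  have hM0 := weightedProd_nonneg s x n t₀
  refine ⟨weightedProd s x n t₀, t₀, hM0, ?_, ?_⟩
  · rintro δ t hδ hexp ⟨k, hk, hkt⟩
    rcases le_total 5 |t| with h5 | h5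
    · refine (hdecay h5).trans ?_
      rw [mul_comm]
      gcongr
    · have hzero : weightedProd s x n (x k) = 0 := by
        rw [weightedProd, Finset.prod_eq_zero hk (by simp), zero_mul]
      have h1 := abs_sub_abs_le_abs_sub (x k) t
      have h2 := (le_abs_self _).trans (hlip (t := t) (u := x k) (by linarith) (by linarith))
      rw [hzero, sub_zero, abs_sub_comm] at h2
      refine h2.trans ?_
      have : 0 ≤ L * n * weightedProd s x n t₀ := by positivity
      nlinarith [mul_le_mul_of_nonneg_left hkt this]
  · intro t ht
    rcases hM0.eq_or_lt with h0 | hpos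
    · rw [← h0, zero_div]; exact weightedProd_nonneg s x n t
    have h5 : |t₀| < 5 := by
      by_contra! h
      have h1 := hdecay h
      have h2 : Real.exp (-n) < 1 := by rw [← Real.exp_zero]; exact Real.exp_lt_exp.2 (by linarith)
      nlinarith
    have hLn : 1 ≤ L * n := one_le_mul_of_one_le_of_one_le hL hn
    have h1 : 1 / (2 * (L * n)) ≤ 1 := by
      rw [div_le_one (by linarith)]; linarith
    have h2 := abs_sub_abs_le_abs_sub t t₀
    have h3 := (abs_le.1 (hlip (t := t) (u := t₀) (by linarith) (by linarith))).1
    have h4 : L * n * weightedProd s x n t₀ * |t - t₀| ≤ weightedProd s x n t₀ / 2 := by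
      rw [le_div_iff₀ (by linarith)] at ht
      nlinarith
    linarith

end WeightedPolynomial

section GaussianEnsemble

/-- The `β`-th power of a weighted polynomial of degree at most `n` puts at most a fraction of order
`(n δ) ^ (β + 1)` of its mass within distance `δ` of a given root. -/
theorem setLIntegral_weightedProd_rpow_le : ∃ L : ℝ, 1 ≤ L ∧
    ∀ {ι : Type} (s : Finset ι) (x : ι → ℝ) (n β δ : ℝ), s.card ≤ n → 1 ≤ n → 0 ≤ β → 0 < δ →
    δ ≤ 1 → Real.exp (-n) ≤ L * n * δ → ∀ k ∈ s,
      ∫⁻ t in Metric.closedBall (x k) δ, ENNReal.ofReal (weightedProd s x n t ^ β) ≤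
        ENNReal.ofReal ((2 * L * n * δ) ^ (β + 1)) *
          ∫⁻ t, ENNReal.ofReal (weightedProd s x n t ^ β) := by
  obtain ⟨L, hL, H⟩ := exists_forall_weightedProd_le_and_ge
  refine ⟨L, hL, fun {ι} s x n β δ hs hn hβ hδ hδ1 hexp k hk => ?_⟩
  obtain ⟨M, t₀, hM, hnear, hpeak⟩ := H s x n hs hn
  have hLn : 0 < L * n := by positivity
  have hbase : 0 < 2 * L * n * δ := by positivity
  have lower : ENNReal.ofReal ((M / 2) ^ β) * ENNReal.ofReal (2 * (1 / (2 * (L * n)))) ≤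
      ∫⁻ t, ENNReal.ofReal (weightedProd s x n t ^ β) := by
    rw [← Real.volume_closedBall t₀, ← setLIntegral_const]
    refine (setLIntegral_mono' measurableSet_closedBall fun t ht => ?_).trans
      (setLIntegral_le_lintegral _ _)
    exact ENNReal.ofReal_le_ofReal (Real.rpow_le_rpow (by positivity)
      (hpeak t (by rwa [Metric.mem_closedBall, Real.dist_eq] at ht)) hβ)
  have upper : ∫⁻ t in Metric.closedBall (x k) δ, ENNReal.ofReal (weightedProd s x n t ^ β) ≤
      ENNReal.ofReal ((L * n * δ * M) ^ β) * ENNReal.ofReal (2 * δ) := by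
    rw [← Real.volume_closedBall (x k), ← setLIntegral_const]
    refine setLIntegral_mono' measurableSet_closedBall fun t ht => ?_
    rw [Metric.mem_closedBall, Real.dist_eq, abs_sub_comm] at ht
    exact ENNReal.ofReal_le_ofReal (Real.rpow_le_rpow (weightedProd_nonneg _ _ _ _)
      (hnear δ t hδ1 hexp ⟨k, hk, ht⟩) hβ)
  refine upper.trans (le_trans (le_of_eq ?_) (mul_le_mul_right lower _))
  rw [← ENNReal.ofReal_mul (by positivity), ← ENNReal.ofReal_mul (by positivity),
    ← ENNReal.ofReal_mul (by positivity)]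
  congr 1
  rw [Real.rpow_add_one hbase.ne',
    show L * n * δ * M = (2 * L * n * δ) * (M / 2) by ring,
    Real.mul_rpow hbase.le (by positivity)]
  field_simp

/-- As a function of a single particle, the density of the Gaussian beta-ensemble is proportional to
a power of a weighted polynomial whose roots are the other particles. -/
theorem gaussianDensity_update (n : ℕ) (β : ℝ) (x : Fin n → ℝ) (j : Fin n) :
    ∃ c : ℝ, 0 ≤ c ∧ ∀ t : ℝ, gaussianDensity n β (Function.update x j t) =
      c * weightedProd (Finset.univ.erase j) x n t ^ β := by
  refine ⟨(∏ p ∈ (Finset.univ.filter (fun p : Fin n × Fin n => p.1 < p.2)).filter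
      (fun p => ¬ (p.1 = j ∨ p.2 = j)), |x p.1 - x p.2| ^ β) *
      Real.exp (-((n : ℝ) * β / 2) * ∑ k ∈ Finset.univ.erase j, (x k) ^ 2 / 2), by positivity,
      fun t => ?_⟩
  have hpairs : ∏ p ∈ (Finset.univ.filter (fun p : Fin n × Fin n => p.1 < p.2)).filter
      (fun p => p.1 = j ∨ p.2 = j),
        |Function.update x j t p.1 - Function.update x j t p.2| ^ β =
      ∏ k ∈ Finset.univ.erase j, |t - x k| ^ β := by
    refine Finset.prod_nbij' (fun p => if p.1 = j then p.2 else p.1)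
      (fun k => if k < j then (k, j) else (j, k)) ?_ ?_ ?_ ?_ ?_
    · rintro ⟨a, b⟩ h
      simp only [Finset.mem_filter, Finset.mem_univ, true_and] at h
      simp only [Finset.mem_erase, Finset.mem_univ, and_true]
      split_ifs <;> grind
    · intro k h
      simp only [Finset.mem_erase, Finset.mem_univ, and_true] at h
      simp only [Finset.mem_filter, Finset.mem_univ, true_and]
      split_ifs <;> grind
    · rintro ⟨a, b⟩ h
      simp only [Finset.mem_filter, Finset.mem_univ, true_and] at h
      grind
    · intro k h
      simp only [Finset.mem_erase, Finset.mem_univ, and_true] at h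
      grind
    · rintro ⟨a, b⟩ h
      simp only [Finset.mem_filter, Finset.mem_univ, true_and] at h
      obtain ⟨hab, rfl | rfl⟩ := h
      · simp [hab.ne']
      · simp [hab.ne, abs_sub_comm]
  have hrest : ∏ p ∈ (Finset.univ.filter (fun p : Fin n × Fin n => p.1 < p.2)).filter
      (fun p => ¬ (p.1 = j ∨ p.2 = j)),
        |Function.update x j t p.1 - Function.update x j t p.2| ^ β =
      ∏ p ∈ (Finset.univ.filter (fun p : Fin n × Fin n => p.1 < p.2)).filter
      (fun p => ¬ (p.1 = j ∨ p.2 = j)), |x p.1 - x p.2| ^ β := by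
    refine Finset.prod_congr rfl fun p hp => ?_
    have := (Finset.mem_filter.1 hp).2
    push Not at this
    rw [Function.update_of_ne this.1, Function.update_of_ne this.2]
  have hsum : ∑ k, (Function.update x j t k) ^ 2 / 2 =
      t ^ 2 / 2 + ∑ k ∈ Finset.univ.erase j, (x k) ^ 2 / 2 := by
    rw [← Finset.add_sum_erase _ _ (Finset.mem_univ j), Function.update_self]
    congr 1
    refine Finset.sum_congr rfl fun k hk => ?_
    rw [Function.update_of_ne (Finset.ne_of_mem_erase hk)]
  rw [gaussianDensity, hsum, ← Finset.prod_filter_mul_prod_filter_not _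
    (fun p : Fin n × Fin n => p.1 = j ∨ p.2 = j), hpairs, hrest, weightedProd,
    Real.mul_rpow (Finset.prod_nonneg fun _ _ => abs_nonneg _) (Real.exp_pos _).le,
    ← Real.exp_mul, mul_add, Real.exp_add,
    ← Real.finsetProd_rpow _ _ (fun _ _ => abs_nonneg _),
    show -((n : ℝ) * β / 2) * (t ^ 2 / 2) = -n * t ^ 2 / 4 * β by ring]
  ring

/-- Two given particles of the Gaussian beta-ensemble are within `δ` of each other with probability
at most of order `(n δ) ^ (β + 1)`. -/
theorem measure_abs_sub_le_le : ∃ L : ℝ, 1 ≤ L ∧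
    ∀ (n : ℕ) (β Z δ : ℝ) (μ : Measure (Fin n → ℝ)) [IsProbabilityMeasure μ], 0 ≤ β →
    μ = volume.withDensity (fun x => ENNReal.ofReal (gaussianDensity n β x / Z)) → 0 < Z → 0 < δ →
    δ ≤ 1 → Real.exp (-n) ≤ L * n * δ → ∀ i j : Fin n, i ≠ j →
      μ {x | |x i - x j| ≤ δ} ≤ ENNReal.ofReal ((2 * L * n * δ) ^ (β + 1)) := by
  obtain ⟨L, hL, H⟩ := setLIntegral_weightedProd_rpow_le
  refine ⟨L, hL, fun n β Z δ μ _ hβ hμ hZ hδ hδ1 hexp i j hij => ?_⟩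
  set K := ENNReal.ofReal ((2 * L * n * δ) ^ (β + 1))
  set ρ : (Fin n → ℝ) → ℝ≥0∞ := fun x => ENNReal.ofReal (gaussianDensity n β x / Z)
  have hρ : Measurable ρ := ((measurable_gaussianDensity n β).div_const Z).ennreal_ofReal
  have hA : MeasurableSet {x : Fin n → ℝ | |x i - x j| ≤ δ} :=
    measurableSet_le (by fun_prop) measurable_const
  have hn : (1 : ℝ) ≤ n := by exact_mod_cast i.pos
  have htot : ∫⁻ x, ρ x = 1 := by
    rw [← setLIntegral_univ, ← withDensity_apply _ MeasurableSet.univ, ← hμ, measure_univ]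
  rw [hμ, withDensity_apply _ hA, ← lintegral_indicator hA, ← mul_one K, ← htot,
    ← lintegral_const_mul _ hρ]
  refine lintegral_le_of_lmarginal_le {j} (hρ.indicator hA) (hρ.const_mul K) ?_
  rw [lmarginal_singleton, lmarginal_singleton]
  intro x
  obtain ⟨c, hc, hdens⟩ := gaussianDensity_update n β x j
  set f := weightedProd (Finset.univ.erase j) x n
  have hρf (t : ℝ) : ρ (Function.update x j t) =
      ENNReal.ofReal (c / Z) * ENNReal.ofReal (f t ^ β) := by
    rw [← ENNReal.ofReal_mul (by positivity)]
    simp only [ρ, hdens]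
    congr 1
    ring
  have hf : Measurable fun t => ENNReal.ofReal (f t ^ β) :=
    ((continuous_weightedProd _ _ _).measurable.pow_const β).ennreal_ofReal
  have hind (t : ℝ) : {x : Fin n → ℝ | |x i - x j| ≤ δ}.indicator ρ (Function.update x j t) =
      ENNReal.ofReal (c / Z) *
        (Metric.closedBall (x i) δ).indicator (fun t => ENNReal.ofReal (f t ^ β)) t := by
    have hiff : Function.update x j t ∈ {x : Fin n → ℝ | |x i - x j| ≤ δ} ↔
        t ∈ Metric.closedBall (x i) δ := by
      rw [Set.mem_ofPred_eq, Function.update_of_ne hij, Function.update_self, Metric.mem_closedBall,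
        Real.dist_eq, abs_sub_comm]
    by_cases ht : t ∈ Metric.closedBall (x i) δ
    · rw [Set.indicator_of_mem (hiff.2 ht), Set.indicator_of_mem ht, hρf]
    · rw [Set.indicator_of_notMem (hiff.not.2 ht), Set.indicator_of_notMem ht, mul_zero]
  simp only [hind, hρf]
  rw [lintegral_const_mul _ (hf.indicator measurableSet_closedBall),
    lintegral_indicator measurableSet_closedBall, lintegral_const_mul _ (hf.const_mul _),
    lintegral_const_mul _ hf, mul_left_comm]
  refine mul_le_mul_right (H _ x n β δ ?_ hn hβ hδ hδ1 hexp i (by simp [hij])) _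
  rw [Finset.card_erase_of_mem (Finset.mem_univ j), Finset.card_univ, Fintype.card_fin]
  exact_mod_cast Nat.sub_le n 1

/-- A union bound for the event that some spacing is at most `δ`. -/
theorem measure_exists_abs_sub_le_le : ∃ L : ℝ, 1 ≤ L ∧
    ∀ (n : ℕ) (β Z δ : ℝ) (μ : Measure (Fin n → ℝ)) [IsProbabilityMeasure μ], 0 ≤ β →
    μ = volume.withDensity (fun x => ENNReal.ofReal (gaussianDensity n β x / Z)) → 0 < Z → 0 < δ →
    δ ≤ 1 → Real.exp (-n) ≤ L * n * δ →
      μ {x | ∃ i j, i ≠ j ∧ |x i - x j| ≤ δ} ≤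
        ENNReal.ofReal (n ^ 2 * (2 * L * n * δ) ^ (β + 1)) := by
  obtain ⟨L, hL, H⟩ := measure_abs_sub_le_le
  refine ⟨L, hL, fun n β Z δ μ _ hβ hμ hZ hδ hδ1 hexp => ?_⟩
  have hsub : {x : Fin n → ℝ | ∃ i j, i ≠ j ∧ |x i - x j| ≤ δ} ⊆
      ⋃ p ∈ (Finset.univ : Finset (Fin n × Fin n)).filter (fun p => p.1 ≠ p.2),
        {x | |x p.1 - x p.2| ≤ δ} := by
    rintro x ⟨i, j, hij, h⟩
    simp only [Set.mem_iUnion]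
    exact ⟨(i, j), by simpa using hij, h⟩
  refine (measure_mono hsub).trans ((measure_biUnion_finset_le _ _).trans ?_)
  refine (Finset.sum_le_card_nsmul _ _ _ fun p hp =>
    H n β Z δ μ hβ hμ hZ hδ hδ1 hexp p.1 p.2 (Finset.mem_filter.1 hp).2).trans ?_
  rw [ENNReal.ofReal_mul (by positivity), nsmul_eq_mul]
  gcongr
  rw [← Nat.cast_pow, ENNReal.ofReal_natCast]
  refine Nat.cast_le.2 ((Finset.card_filter_le _ _).trans ?_)
  simp [sq]

theorem le_minGap {n : ℕ} (hn : 2 ≤ n) {x : Fin n → ℝ} {δ : ℝ}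
    (h : ∀ i j, i ≠ j → δ ≤ |x i - x j|) : δ ≤ minGap n x := by
  refine le_csInf ?_ ?_
  · exact ⟨_, (⟨0, by omega⟩, ⟨1, by omega⟩), by simp, rfl⟩
  · rintro _ ⟨p, hp, rfl⟩
    exact h _ _ hp

end GaussianEnsemble

/-- Almost sure lower bound on the non-normalized minimal spacing at fixed temperature. -/
theorem minimal_spacing_fixed_beta
    (β₀ : ℝ) (hβ₀ : 1 ≤ β₀) (τ : ℝ) (hτ : 1 < τ)
    (β : ℕ → ℝ) (hβ : ∀ n, β n = β₀)
    (Z : ℕ → ℝ) (hZ : ∀ n, 0 < Z n)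
    (μ : (n : ℕ) → Measure (Fin n → ℝ))
    (hμ : ∀ n, μ n =
      volume.withDensity (fun x => ENNReal.ofReal (gaussianDensity n (β n) x / Z n)))
    (hμprob : ∀ n, IsProbabilityMeasure (μ n))
    (P : Measure ((n : ℕ) → Fin n → ℝ)) (hPprob : IsProbabilityMeasure P)
    (hP : ∀ (S : Finset ℕ) (A : (n : ℕ) → Set (Fin n → ℝ)),
      (∀ n ∈ S, MeasurableSet (A n)) →
      P {ω | ∀ n ∈ S, ω n ∈ A n} = ∏ n ∈ S, μ n (A n)) :
    ∀ᵐ ω ∂P,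
      0 < Filter.liminf
        (fun n : ℕ => ENNReal.ofReal
          ((n : ℝ) ^ ((β₀ + 2 + τ) / β₀) * minGap n (ω n)))
        atTop := by
  obtain ⟨L, hL, H⟩ := measure_exists_abs_sub_le_le
  set κ : ℝ := (β₀ + 2 + τ) / β₀ with hκ
  have hβpos : 0 < β₀ := by linarith
  have hκ1 : 1 ≤ κ := by rw [hκ, le_div_iff₀ hβpos]; linarith
  let A : (n : ℕ) → Set (Fin n → ℝ) := fun n =>
    {x | ∃ i j, i ≠ j ∧ |x i - x j| ≤ (n : ℝ) ^ (-κ)}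
  have hA (n : ℕ) : MeasurableSet (A n) := by
    have : A n = ⋃ i, ⋃ j, {x | i ≠ j ∧ |x i - x j| ≤ (n : ℝ) ^ (-κ)} := by
      ext x; simp [A]
    rw [this]
    exact MeasurableSet.iUnion fun i => MeasurableSet.iUnion fun j =>
      (MeasurableSet.const _).inter (measurableSet_le
        (f := fun x : Fin n → ℝ => |x i - x j|) (by fun_prop) measurable_const)
  have hPA (n : ℕ) : P {ω | ω n ∈ A n} = μ n (A n) := by
    simpa using hP {n} A fun m _ => hA m
  have hexp : ∀ᶠ n : ℕ in atTop, Real.exp (-n) ≤ L * n * (n : ℝ) ^ (-κ) := by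
    have h1 := tendsto_natCast_atTop_atTop.eventually
      ((isLittleO_exp_neg_mul_rpow_atTop one_pos (-κ)).bound one_pos)
    filter_upwards [h1, eventually_ge_atTop 1] with n h hn
    have hn1 : (1 : ℝ) ≤ n := by exact_mod_cast hn
    have hpos : 0 ≤ (n : ℝ) ^ (-κ) := by positivity
    rw [neg_one_mul, one_mul, Real.norm_of_nonneg (Real.exp_pos _).le,
      Real.norm_of_nonneg hpos] at h
    exact h.trans (le_mul_of_one_le_left hpos (one_le_mul_of_one_le_of_one_le hL hn1))
  obtain ⟨N, hN⟩ := eventually_atTop.1 hexp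
  have hbound (n : ℕ) (hn : max N 1 ≤ n) : P {ω | ω n ∈ A n} ≤
      ENNReal.ofReal ((2 * L) ^ (β₀ + 1) * (n : ℝ) ^ (-(τ + (2 + τ) / β₀))) := by
    have hn1 : (1 : ℝ) ≤ n := by exact_mod_cast (le_max_right N 1).trans hn
    have hn0 : (0 : ℝ) < n := by linarith
    rw [hPA]
    have := hμprob n
    refine (H n (β n) (Z n) _ (μ n) (by rw [hβ]; exact hβpos.le) (hμ n) (hZ n)
      (Real.rpow_pos_of_pos hn0 _) (Real.rpow_le_one_of_one_le_of_nonpos hn1 (by linarith))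
      (hN n ((le_max_left N 1).trans hn))).trans (le_of_eq ?_)
    congr 1
    have h1 : (2 * L * n * (n : ℝ) ^ (-κ)) = 2 * L * (n : ℝ) ^ (1 - κ) := by
      rw [sub_eq_add_neg, Real.rpow_add hn0, Real.rpow_one]; ring
    rw [hβ, h1, Real.mul_rpow (by positivity) (by positivity), ← Real.rpow_mul hn0.le,
      mul_left_comm, ← Real.rpow_natCast, ← Real.rpow_add hn0]
    congr 2
    rw [hκ]
    field_simp
    push_cast
    ring
  have hsum : ∑' n, P (if max N 1 ≤ n then {ω | ω n ∈ A n} else ∅) ≠ ∞ := by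
    have hs : Summable fun n : ℕ => (2 * L) ^ (β₀ + 1) * (n : ℝ) ^ (-(τ + (2 + τ) / β₀)) := by
      refine Summable.mul_left _ (Real.summable_nat_rpow.2 ?_)
      have : 0 < (2 + τ) / β₀ := by positivity
      linarith
    refine ne_top_of_le_ne_top hs.tsum_ofReal_ne_top (ENNReal.tsum_le_tsum fun n => ?_)
    split_ifs with h
    · exact hbound n h
    · simp
  filter_upwards [ae_eventually_notMem hsum] with ω hω
  refine lt_of_lt_of_le one_pos (le_liminf_of_le (by isBoundedDefault) ?_)
  filter_upwards [hω, eventually_ge_atTop (max N 1), eventually_ge_atTop 2] with n h hn hn2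
  rw [if_pos hn] at h
  have hn0 : (0 : ℝ) < n := by exact_mod_cast (by omega : 0 < n)
  have hgap : (n : ℝ) ^ (-κ) ≤ minGap n (ω n) := le_minGap hn2 fun i j hij => by
    by_contra! hlt
    exact h ⟨i, j, hij, hlt.le⟩
  rw [ENNReal.one_le_ofReal]
  calc (1 : ℝ) = (n : ℝ) ^ κ * (n : ℝ) ^ (-κ) := by
        rw [← Real.rpow_add hn0, add_neg_cancel, Real.rpow_zero]
    _ ≤ _ := by gcongr
end
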